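/- arXiv:gr-qc/0608040 — 2 statements merged into one kernel-verified Lean document; each statement's English description precedes it below -/
import Mathlib

section
/- Let λ ∈ (0, 1/16), ν = √(1 − 16λ), t₁ = (1 − ν)/(4λ), t₂ = (1 + ν)/(4λ), λ₁ = (ν + 1)/(2ν), λ₂ = (ν − 1)/(2ν). If x : (0, t₁) → ℝ is differentiable and satisfies the outgoing radial null condition dx/dt = (1/2 − λt)/(1 − t/2 + λt²), then the function t ↦ e^{x(t)} (t₁ − t)^{λ₁} (t₂ − t)^{λ₂} is constant on (0, t₁). -/
/-- With λ ∈ (0,1/16), ν = √(1−16λ), t₁ = (1−ν)/(4λ), t₂ = (1+ν)/(4λ),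
lam₁ = (ν+1)/(2ν), lam₂ = (ν−1)/(2ν): if x : (0,t₁) → ℝ is differentiable with
dx/dt = (1/2 − λt)/(1 − t/2 + λt²) (the outgoing radial null condition), then
t ↦ e^{x(t)}(t₁−t)^{lam₁}(t₂−t)^{lam₂} is constant on (0,t₁). -/
theorem stmt_7 (lam ν t₁ t₂ lam₁ lam₂ : ℝ) (hlam : lam ∈ Set.Ioo (0:ℝ) (1/16))
    (hν : ν = Real.sqrt (1 - 16*lam)) (ht₁ : t₁ = (1 - ν)/(4*lam))
    (ht₂ : t₂ = (1 + ν)/(4*lam))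
    (hlam₁ : lam₁ = (ν + 1)/(2*ν)) (hlam₂ : lam₂ = (ν - 1)/(2*ν))
    (x : ℝ → ℝ)
    (hx : ∀ t ∈ Set.Ioo (0:ℝ) t₁,
      HasDerivAt x ((1/2 - lam*t)/(1 - t/2 + lam*t^2)) t) :
    ∀ t ∈ Set.Ioo (0:ℝ) t₁, ∀ s ∈ Set.Ioo (0:ℝ) t₁,
      Real.exp (x t) * (t₁ - t) ^ lam₁ * (t₂ - t) ^ lam₂
        = Real.exp (x s) * (t₁ - s) ^ lam₁ * (t₂ - s) ^ lam₂ := by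
  obtain ⟨hl0, hl1⟩ := hlam
  have hν0 : 0 < ν := hν ▸ Real.sqrt_pos.2 (by linarith)
  have hνsq : ν ^ 2 = 1 - 16 * lam := by rw [hν, Real.sq_sqrt (by linarith)]
  have ht : t₁ < t₂ := by
    rw [ht₁, ht₂]
    exact div_lt_div_of_pos_right (by linarith) (by linarith)
  have hsum : lam₁ + lam₂ = 1 := by
    rw [hlam₁, hlam₂]; field_simp; ring
  have hmix : lam * (lam₁ * t₂ + lam₂ * t₁) = 1 / 2 := by
    rw [hlam₁, hlam₂, ht₁, ht₂]; field_simp; ring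
  have hroots_add : lam * (t₁ + t₂) = 1 / 2 := by
    rw [ht₁, ht₂]; field_simp; ring
  have hroots_mul : lam * (t₁ * t₂) = 1 := by
    rw [ht₁, ht₂]; field_simp; linear_combination -hνsq
  have hderiv : ∀ t ∈ Set.Ioo (0:ℝ) t₁, HasDerivAt
      (fun t => x t + lam₁ * Real.log (t₁ - t) + lam₂ * Real.log (t₂ - t)) 0 t := by
    intro t htt
    have h₁ : t₁ - t ≠ 0 := by linarith [htt.2]
    have h₂ : t₂ - t ≠ 0 := by linarith [htt.2]
    have hfac : 1 - t/2 + lam*t^2 = lam * (t₁ - t) * (t₂ - t) := by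
      linear_combination -hroots_mul + t * hroots_add
    have hd := ((hx t htt).add ((((hasDerivAt_id t).const_sub t₁).log h₁).const_mul lam₁)).add
      ((((hasDerivAt_id t).const_sub t₂).log h₂).const_mul lam₂)
    refine hd.congr_deriv ?_
    rw [hfac]
    simp only [id]
    field_simp
    linear_combination -2 * hmix + 2 * lam * t * hsum
  have hexp : ∀ t ∈ Set.Ioo (0:ℝ) t₁,
      Real.exp (x t) * (t₁ - t) ^ lam₁ * (t₂ - t) ^ lam₂ =
        Real.exp (x t + lam₁ * Real.log (t₁ - t) + lam₂ * Real.log (t₂ - t)) := by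
    intro t htt
    rw [Real.rpow_def_of_pos (by linarith [htt.2]), Real.rpow_def_of_pos (by linarith [htt.2]),
      Real.exp_add, Real.exp_add, mul_comm lam₁, mul_comm lam₂]
  intro t htt s hs
  rw [hexp t htt, hexp s hs]
  exact congrArg Real.exp (isOpen_Ioo.is_const_of_deriv_eq_zero isPreconnected_Ioo
    (fun r hr => (hderiv r hr).differentiableAt.differentiableWithinAt)
    (fun r hr => (hderiv r hr).deriv) htt hs)
end

section
/- Let f, g, μ₀ ∈ C_0^∞(ℝ) and let Π ∈ C^∞([t_i, t₁) × ℝ) be the unique solution of the master equation with κ = 0 and initial data Π(t_i,·) = f, Π_t(t_i,·) = g, extended smoothly in x to t = t₁. Define Ψ(t,x) = e^{3x}Π(t,x), and introduce the null coordinates X = (t₁ − t)(t₂ − t)^{(ν−1)/(ν+1)} e^{x/λ₁} with λ₁ = (ν+1)/(2ν), and Y = t e^x. Then there exists X₀ > 0 such that Ψ, expressed as a function of (X, Y), extends to a C^∞ function on Ω = {(X,Y) : 0 ≤ X ≤ X₀, Y > 0}. In particular, all partial derivatives of Ψ with respect to X and Y are finite at the Cauchy horizon X = 0. -/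
/-- Partial derivative with respect to the first (time) variable. -/
noncomputable def ptD (φ : ℝ → ℝ → ℝ) (t x : ℝ) : ℝ := deriv (fun s => φ s x) t

/-- Partial derivative with respect to the second (space) variable. -/
noncomputable def pxD (φ : ℝ → ℝ → ℝ) (t x : ℝ) : ℝ := deriv (fun y => φ t y) x

/-- The odd-parity master equation for self-similar Vaidya spacetime at the point (t,x),
with α(t) = −2t(1 − t/2 + λt²), β(t) = 1 − t + 2λt², γ(t) = 1 − 2λt:
α φ_tt + 2β φ_tx + γ φ_xx + (α′ + (6−2κ)β) φ_t + (β′ + (6−2κ)γ) φ_x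
  + ((4−κ)β′ + (κ²−6κ+8)γ − ℓ) φ = 8λ e^{(κ−3)x} μ₀(t e^x). -/
def MasterEqAt (lam ell κ : ℝ) (μ₀ : ℝ → ℝ) (φ : ℝ → ℝ → ℝ) (t x : ℝ) : Prop :=
  (-2*t*(1 - t/2 + lam*t^2)) * ptD (ptD φ) t x
    + 2*(1 - t + 2*lam*t^2) * ptD (pxD φ) t x
    + (1 - 2*lam*t) * pxD (pxD φ) t x
    + ((-2 + 2*t - 6*lam*t^2) + (6 - 2*κ)*(1 - t + 2*lam*t^2)) * ptD φ t x
    + ((-1 + 4*lam*t) + (6 - 2*κ)*(1 - 2*lam*t)) * pxD φ t x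
    + ((4 - κ)*(-1 + 4*lam*t) + (κ^2 - 6*κ + 8)*(1 - 2*lam*t) - ell) * φ t x
    = 8*lam*Real.exp ((κ - 3)*x) * μ₀ (t * Real.exp x)

/-- φ is a smooth solution of the master equation on [t_i, t₁) × ℝ with initial data
φ(t_i,·) = f, φ_t(t_i,·) = g, whose slices x ↦ φ(t,x) have compact support. -/
def IsMasterSol (lam ell κ ti t₁ : ℝ) (μ₀ f g : ℝ → ℝ) (φ : ℝ → ℝ → ℝ) : Prop :=
  ContDiffOn ℝ (⊤ : ℕ∞) (fun p : ℝ × ℝ => φ p.1 p.2) (Set.Ico ti t₁ ×ˢ Set.univ)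
  ∧ (∀ t ∈ Set.Ico ti t₁, ∀ x : ℝ, MasterEqAt lam ell κ μ₀ φ t x)
  ∧ (∀ x : ℝ, φ ti x = f x)
  ∧ (∀ x : ℝ, ptD φ ti x = g x)
  ∧ ∀ t ∈ Set.Ico ti t₁, HasCompactSupport (fun x => φ t x)

/-- The retarded null coordinate X = |u|^{1/λ₁} = (t₁−t)(t₂−t)^{(ν−1)/(ν+1)} e^{x/λ₁},
which vanishes at the Cauchy horizon t = t₁. -/
noncomputable def Xcoord (t₁ t₂ ν lam₁ t x : ℝ) : ℝ :=
  (t₁ - t) * (t₂ - t) ^ ((ν - 1)/(ν + 1)) * Real.exp (x/lam₁)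

section GoursatSmoothness

open Set Filter Topology MeasureTheory

/-- A function of two variables whose partial derivatives are of class `C^n` is of class
`C^(n+1)`. -/
theorem contDiff_succ_of_partials {n : ℕ} {W W₁ W₂ : ℝ → ℝ → ℝ}
    (h₁ : ∀ x y, HasDerivAt (fun s => W s y) (W₁ x y) x)
    (h₂ : ∀ x y, HasDerivAt (fun r => W x r) (W₂ x y) y)
    (c₁ : ContDiff ℝ n (fun p : ℝ × ℝ => W₁ p.1 p.2))
    (c₂ : ContDiff ℝ n (fun p : ℝ × ℝ => W₂ p.1 p.2)) :
    ContDiff ℝ (n + 1) (fun p : ℝ × ℝ => W p.1 p.2) := by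
  rw [contDiff_succ_iff_hasFDerivAt]
  let L : ℝ →L[ℝ] (ℝ →L[ℝ] ℝ) := ContinuousLinearMap.toSpanSingletonCLE.toContinuousLinearMap
  have e₁ : ContDiff ℝ n (fun p : ℝ × ℝ => L (W₁ p.1 p.2)) := L.contDiff.comp c₁
  have e₂ : ContDiff ℝ n (fun p : ℝ × ℝ => L (W₂ p.1 p.2)) := L.contDiff.comp c₂
  refine ⟨fun p => (L (W₁ p.1 p.2)).comp (ContinuousLinearMap.fst ℝ ℝ ℝ)
    + (L (W₂ p.1 p.2)).comp (ContinuousLinearMap.snd ℝ ℝ ℝ), ?_, ?_⟩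
  · exact (e₁.clm_comp contDiff_const).add (e₂.clm_comp contDiff_const)
  · intro u
    have := (hasStrictFDerivAt_uncurry_coprod (𝕜 := ℝ) (u := u) (f := W)
      (f₁ := fun x y => L (W₁ x y)) (f₂ := fun x y => L (W₂ x y))
      (Eventually.of_forall fun v => (h₁ v.1 v.2).hasFDerivAt)
      (Eventually.of_forall fun v => (h₂ v.1 v.2).hasFDerivAt)
      e₁.continuous.continuousAt e₂.continuous.continuousAt).hasFDerivAt
    refine this.congr_fderiv ?_
    ext <;> simp [Function.HasUncurry.uncurry]

theorem hasDerivAt_fst_of_contDiff {N : ℝ → ℝ → ℝ} {n : ℕ}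
    (hN : ContDiff ℝ (n + 1) (fun p : ℝ × ℝ => N p.1 p.2)) (x y : ℝ) :
    HasDerivAt (fun s => N s y) (fderiv ℝ (fun p : ℝ × ℝ => N p.1 p.2) (x, y) (1, 0)) x := by
  have h := (hN.differentiable (by simp)).differentiableAt (x := (x, y)) |>.hasFDerivAt
  exact h.comp_hasDerivAt x ((hasDerivAt_id x).prodMk (hasDerivAt_const x y))

/-- Differentiation under the integral sign for continuous integrands. -/
theorem hasDerivAt_intervalIntegral_param {N N₁ : ℝ → ℝ → ℝ} (q y : ℝ)
    (hN : Continuous (fun p : ℝ × ℝ => N p.1 p.2))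
    (hN₁ : Continuous (fun p : ℝ × ℝ => N₁ p.1 p.2))
    (h : ∀ x r, HasDerivAt (fun s => N s r) (N₁ x r) x) (x : ℝ) :
    HasDerivAt (fun s => ∫ r in q..y, N s r) (∫ r in q..y, N₁ x r) x := by
  obtain ⟨C, hC⟩ := ((isCompact_Icc (a := x - 1) (b := x + 1)).prod
    (isCompact_uIcc (a := q) (b := y))).exists_bound_of_continuousOn hN₁.continuousOn
  have cN : ∀ s, Continuous (N s) := fun s => hN.comp (by fun_prop : Continuous fun r => (s, r))
  have cN₁ : Continuous (N₁ x) := hN₁.comp (by fun_prop : Continuous fun r => (x, r))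
  refine (intervalIntegral.hasDerivAt_integral_of_dominated_loc_of_deriv_le
    (F := N) (F' := N₁) (s := Icc (x - 1) (x + 1)) (bound := fun _ => C)
    (Icc_mem_nhds (by linarith) (by linarith)) (Eventually.of_forall fun s => ?_)
    ((cN x).intervalIntegrable _ _) ?_ ?_ (by simp) ?_).2
  · exact (cN s).aestronglyMeasurable
  · exact cN₁.aestronglyMeasurable
  · exact Eventually.of_forall fun r hr s hs => hC (s, r) ⟨hs, uIoc_subset_uIcc hr⟩
  · exact Eventually.of_forall fun r _ s _ => h s r

theorem continuous_intervalIntegral_snd {N : ℝ → ℝ → ℝ} (q : ℝ)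
    (hN : Continuous (fun p : ℝ × ℝ => N p.1 p.2)) :
    Continuous (fun p : ℝ × ℝ => ∫ r in q..p.2, N p.1 r) := by
  refine intervalIntegral.continuous_parametric_intervalIntegral_of_continuous
    (f := fun (p : ℝ × ℝ) r => N p.1 r) ?_ continuous_snd
  exact hN.comp (by fun_prop : Continuous fun z : (ℝ × ℝ) × ℝ => (z.1.1, z.2))

/-- The primitive in the second variable of a `C^n` function of two variables is `C^n`. -/
theorem contDiff_intervalIntegral_snd (n : ℕ) : ∀ {N : ℝ → ℝ → ℝ} (q : ℝ)
    (_ : ContDiff ℝ n (fun p : ℝ × ℝ => N p.1 p.2)),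
    ContDiff ℝ n (fun p : ℝ × ℝ => ∫ r in q..p.2, N p.1 r) := by
  induction n with
  | zero =>
    intro N q hN
    simp only [Nat.cast_zero, contDiff_zero] at hN ⊢
    exact continuous_intervalIntegral_snd q hN
  | succ n ih =>
    intro N q hN
    push_cast at hN ⊢
    have c : ContDiff ℝ n (fun p : ℝ × ℝ => fderiv ℝ (fun p : ℝ × ℝ => N p.1 p.2) p (1, 0)) :=
      (hN.fderiv_right (m := n) le_rfl).clm_apply contDiff_const
    refine contDiff_succ_of_partials (W := fun x y => ∫ r in q..y, N x r)
      (W₁ := fun x y => ∫ r in q..y, fderiv ℝ (fun p : ℝ × ℝ => N p.1 p.2) (x, r) (1, 0))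
      (W₂ := N) ?_ ?_ ?_ ?_
    · intro x y
      exact hasDerivAt_intervalIntegral_param q y hN.continuous c.continuous
        (hasDerivAt_fst_of_contDiff hN) x
    · intro x y
      have cN : Continuous (N x) := hN.continuous.comp (by fun_prop : Continuous fun r => (x, r))
      exact intervalIntegral.integral_hasDerivAt_right (cN.intervalIntegrable _ _)
        (cN.stronglyMeasurableAtFilter _ _) cN.continuousAt
    · exact ih (N := fun x r => fderiv ℝ (fun p : ℝ × ℝ => N p.1 p.2) (x, r) (1, 0)) q c
    · exact hN.of_le (by exact_mod_cast Nat.le_succ n)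

/-- The double primitive of a `C^n` function of two variables is `C^(n+1)`. -/
theorem contDiff_succ_iterated_intervalIntegral {n : ℕ} {N : ℝ → ℝ → ℝ} (p q : ℝ)
    (hN : ContDiff ℝ n (fun z : ℝ × ℝ => N z.1 z.2)) :
    ContDiff ℝ (n + 1) (fun z : ℝ × ℝ => ∫ s in p..z.1, ∫ r in q..z.2, N s r) := by
  have c₁ := contDiff_intervalIntegral_snd n q hN
  have hN' : ContDiff ℝ n (fun z : ℝ × ℝ => N z.2 z.1) :=
    hN.comp (contDiff_snd.prodMk contDiff_fst)
  have c₂ := (contDiff_intervalIntegral_snd n (N := fun y x => N x y) p hN').comp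
    (contDiff_snd.prodMk contDiff_fst)
  have hcont := c₁.continuous
  refine contDiff_succ_of_partials (W := fun x y => ∫ s in p..x, ∫ r in q..y, N s r)
    (W₁ := fun x y => ∫ r in q..y, N x r) (W₂ := fun x y => ∫ s in p..x, N s y) ?_ ?_ c₁ c₂
  · intro x y
    have cN : Continuous (fun s => ∫ r in q..y, N s r) :=
      hcont.comp (by fun_prop : Continuous fun s => (s, y))
    exact intervalIntegral.integral_hasDerivAt_right (cN.intervalIntegrable _ _)
      (cN.stronglyMeasurableAtFilter _ _) cN.continuousAt
  · intro x y
    refine hasDerivAt_intervalIntegral_param (N := fun y s => ∫ r in q..y, N s r)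
      (N₁ := fun y s => N s y) p x
      (hcont.comp (by fun_prop : Continuous fun z : ℝ × ℝ => (z.2, z.1))) hN'.continuous ?_ y
    intro y s
    have cN : Continuous (N s) := hN.continuous.comp (by fun_prop : Continuous fun r => (s, r))
    exact intervalIntegral.integral_hasDerivAt_right (cN.intervalIntegrable _ _)
      (cN.stronglyMeasurableAtFilter _ _) cN.continuousAt

/-- Continuous solutions of the Goursat integral equation with smooth coefficients are smooth. -/
theorem contDiff_of_goursat {p q : ℝ} {K a u : ℝ → ℝ → ℝ}
    (hK : ContDiff ℝ (⊤ : ℕ∞) (fun z : ℝ × ℝ => K z.1 z.2))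
    (ha : ContDiff ℝ (⊤ : ℕ∞) (fun z : ℝ × ℝ => a z.1 z.2))
    (hu : Continuous (fun z : ℝ × ℝ => u z.1 z.2))
    (h : ∀ x y, u x y = a x y + ∫ s in p..x, ∫ r in q..y, K s r * u s r) :
    ContDiff ℝ (⊤ : ℕ∞) (fun z : ℝ × ℝ => u z.1 z.2) := by
  rw [contDiff_infty]
  intro n
  induction n with
  | zero => exact contDiff_zero.2 hu
  | succ n ih =>
    have e : (fun z : ℝ × ℝ => u z.1 z.2) = fun z : ℝ × ℝ =>
      a z.1 z.2 + ∫ s in p..z.1, ∫ r in q..z.2, K s r * u s r := funext fun z => h z.1 z.2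
    rw [e]
    refine (contDiff_infty.1 ha (n + 1)).add ?_
    exact contDiff_succ_iterated_intervalIntegral p q ((contDiff_infty.1 hK n).mul ih)

end GoursatSmoothness

section GoursatPicard

open Set Filter Topology MeasureTheory

theorem abs_integral_exp_abs_sub_le {L : ℝ} (hL : 0 < L) (q y : ℝ) :
    |∫ r in q..y, Real.exp (L * |r - q|)| ≤ Real.exp (L * |y - q|) / L := by
  have key : ∀ c : ℝ, 0 ≤ c → ∫ r in (0 : ℝ)..c, Real.exp (L * r) ≤ Real.exp (L * c) / L := by
    intro c _
    have : ∫ r in (0 : ℝ)..c, Real.exp (L * r) = (Real.exp (L * c) - 1) / L := by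
      rw [intervalIntegral.integral_comp_mul_left (fun r => Real.exp r) hL.ne', integral_exp]
      simp; ring
    rw [this]
    gcongr
    linarith
  have shift : ∫ r in q..y, Real.exp (L * |r - q|) = ∫ r in (0 : ℝ)..(y - q), Real.exp (L * |r|) := by
    rw [intervalIntegral.integral_comp_sub_right (fun r => Real.exp (L * |r|)) q, sub_self]
  have pos : ∀ c : ℝ, 0 ≤ c → |∫ r in (0 : ℝ)..c, Real.exp (L * |r|)| ≤ Real.exp (L * c) / L := by
    intro c hc
    rw [abs_of_nonneg (intervalIntegral.integral_nonneg hc fun _ _ => (Real.exp_pos _).le)]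
    refine le_trans (le_of_eq ?_) (key c hc)
    refine intervalIntegral.integral_congr fun r hr => ?_
    rw [uIcc_of_le hc] at hr
    simp only [abs_of_nonneg hr.1]
  rw [shift]
  rcases le_total 0 (y - q) with h | h
  · rw [abs_of_nonneg h]; exact pos _ h
  · have e : ∫ r in (0 : ℝ)..(y - q), Real.exp (L * |r|)
        = -∫ r in (0 : ℝ)..(-(y - q)), Real.exp (L * |r|) := by
      have := intervalIntegral.integral_comp_neg (a := 0) (b := -(y - q))
        (fun r => Real.exp (L * |r|))
      simp only [abs_neg, neg_neg, neg_zero] at this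
      rw [this, intervalIntegral.integral_symm]
    rw [e, abs_neg, abs_of_nonpos h]
    exact pos _ (by linarith)

/-- Exponentially weighted bound for the double integral of the Goursat problem. -/
theorem abs_iterated_integral_le {L M : ℝ} (hL : 0 < L) (hM : 0 ≤ M) {f : ℝ → ℝ → ℝ}
    {p q x y : ℝ}
    (h : ∀ s ∈ uIcc p x, ∀ r ∈ uIcc q y,
      |f s r| ≤ M * (Real.exp (L * |s - p|) * Real.exp (L * |r - q|))) :
    |∫ s in p..x, ∫ r in q..y, f s r|
      ≤ M / L ^ 2 * (Real.exp (L * |x - p|) * Real.exp (L * |y - q|)) := by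
  have inner : ∀ s ∈ uIcc p x, |∫ r in q..y, f s r|
      ≤ M * Real.exp (L * |y - q|) / L * Real.exp (L * |s - p|) := by
    intro s hs
    have := intervalIntegral.norm_integral_le_abs_of_norm_le (μ := volume) (a := q) (b := y)
      (f := f s) (g := fun r => M * (Real.exp (L * |s - p|) * Real.exp (L * |r - q|)))
      ((ae_restrict_iff' measurableSet_uIoc).2 (Eventually.of_forall fun r hr => by
        exact h s hs r (uIoc_subset_uIcc hr)))
      (Continuous.intervalIntegrable (by fun_prop) _ _)
    rw [Real.norm_eq_abs] at this
    refine this.trans ?_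
    rw [intervalIntegral.integral_const_mul, intervalIntegral.integral_const_mul, abs_mul, abs_mul,
      abs_of_nonneg hM, Real.abs_exp]
    calc M * (Real.exp (L * |s - p|) * |∫ r in q..y, Real.exp (L * |r - q|)|)
        ≤ M * (Real.exp (L * |s - p|) * (Real.exp (L * |y - q|) / L)) := by
          gcongr; exact abs_integral_exp_abs_sub_le hL q y
      _ = _ := by ring
  have := intervalIntegral.norm_integral_le_abs_of_norm_le (μ := volume) (a := p) (b := x)
    (f := fun s => ∫ r in q..y, f s r)
    (g := fun s => M * Real.exp (L * |y - q|) / L * Real.exp (L * |s - p|))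
    ((ae_restrict_iff' measurableSet_uIoc).2 (Eventually.of_forall fun s hs => by
        exact inner s (uIoc_subset_uIcc hs)))
    (Continuous.intervalIntegrable (by fun_prop) _ _)
  rw [Real.norm_eq_abs] at this
  refine this.trans ?_
  rw [intervalIntegral.integral_const_mul, abs_mul,
    abs_of_nonneg (by positivity : 0 ≤ M * Real.exp (L * |y - q|) / L)]
  calc M * Real.exp (L * |y - q|) / L * |∫ s in p..x, Real.exp (L * |s - p|)|
      ≤ M * Real.exp (L * |y - q|) / L * (Real.exp (L * |x - p|) / L) := by
        gcongr; exact abs_integral_exp_abs_sub_le hL p x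
    _ = _ := by field_simp

/-- Uniqueness for the homogeneous Goursat integral equation on a rectangle. -/
theorem goursat_unique {p q x y : ℝ} {K u : ℝ → ℝ → ℝ}
    (hK : ContinuousOn (fun z : ℝ × ℝ => K z.1 z.2) (uIcc p x ×ˢ uIcc q y))
    (hu : ContinuousOn (fun z : ℝ × ℝ => u z.1 z.2) (uIcc p x ×ˢ uIcc q y))
    (h : ∀ x' ∈ uIcc p x, ∀ y' ∈ uIcc q y,
      u x' y' = ∫ s in p..x', ∫ r in q..y', K s r * u s r) :
    u x y = 0 := by
  have hR : IsCompact (uIcc p x ×ˢ uIcc q y) := isCompact_uIcc.prod isCompact_uIcc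
  obtain ⟨C, hC⟩ := hR.exists_bound_of_continuousOn hK
  have hmem : ((x, y) : ℝ × ℝ) ∈ uIcc p x ×ˢ uIcc q y := ⟨right_mem_uIcc, right_mem_uIcc⟩
  have hC0 : 0 ≤ C := (norm_nonneg _).trans (hC _ hmem)
  set L : ℝ := C + 1 with hLdef
  have hL : 0 < L := by linarith
  let m : ℝ × ℝ → ℝ := fun z =>
    |u z.1 z.2| / (Real.exp (L * |z.1 - p|) * Real.exp (L * |z.2 - q|))
  have hm : ContinuousOn m (uIcc p x ×ˢ uIcc q y) := by
    refine hu.abs.div (Continuous.continuousOn (by fun_prop)) fun z _ => by positivity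
  obtain ⟨z, hz, hmax⟩ := hR.exists_isMaxOn ⟨_, hmem⟩ hm
  set M := m z with hMdef
  have hM : 0 ≤ M := by simp only [hMdef, m]; positivity
  have hbound : ∀ s ∈ uIcc p x, ∀ r ∈ uIcc q y,
      |u s r| ≤ M * (Real.exp (L * |s - p|) * Real.exp (L * |r - q|)) := by
    intro s hs r hr
    have : m (s, r) ≤ M := hmax (show ((s, r) : ℝ × ℝ) ∈ _ from ⟨hs, hr⟩)
    simp only [m] at this
    rwa [div_le_iff₀ (by positivity)] at this
  have hle : M ≤ C * M / L ^ 2 := by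
    have h1 := abs_iterated_integral_le (L := L) (M := C * M) hL (by positivity)
      (f := fun s r => K s r * u s r) (p := p) (q := q) (x := z.1) (y := z.2) (by
        intro s hs r hr
        have hs' := uIcc_subset_uIcc_left hz.1 hs
        have hr' := uIcc_subset_uIcc_left hz.2 hr
        rw [abs_mul, mul_assoc]
        exact mul_le_mul (hC (s, r) ⟨hs', hr'⟩) (hbound s hs' r hr') (abs_nonneg _) hC0)
    rw [← h _ hz.1 _ hz.2] at h1
    rw [hMdef]
    simp only [m]
    rwa [div_le_iff₀ (by positivity)]
  have hM0 : M = 0 := by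
    rw [le_div_iff₀ (by positivity)] at hle
    have : M * (L ^ 2 - C) ≤ 0 := by linarith
    have hp : 0 < L ^ 2 - C := by rw [hLdef]; nlinarith
    nlinarith
  have := hbound x right_mem_uIcc y right_mem_uIcc
  rw [hM0, zero_mul] at this
  exact abs_nonpos_iff.1 this

/-- Existence of a global continuous solution of the Goursat integral equation with bounded
continuous coefficients. -/
theorem goursat_exists {p q : ℝ} {K a : ℝ → ℝ → ℝ}
    (hK : Continuous (fun z : ℝ × ℝ => K z.1 z.2)) {C : ℝ} (hC : ∀ s r, |K s r| ≤ C)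
    (ha : Continuous (fun z : ℝ × ℝ => a z.1 z.2)) {D : ℝ} (hD : ∀ s r, |a s r| ≤ D) :
    ∃ u : ℝ → ℝ → ℝ, Continuous (fun z : ℝ × ℝ => u z.1 z.2) ∧
      ∀ x y, u x y = a x y + ∫ s in p..x, ∫ r in q..y, K s r * u s r := by
  have hC0 : 0 ≤ C := (abs_nonneg _).trans (hC 0 0)
  have hD0 : 0 ≤ D := (abs_nonneg _).trans (hD 0 0)
  set L : ℝ := C + 1 with hLdef
  have hL : 0 < L := by linarith
  let w : ℝ × ℝ → ℝ := fun z => Real.exp (L * |z.1 - p|) * Real.exp (L * |z.2 - q|)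
  have hw : ∀ z, 1 ≤ w z := fun z =>
    one_le_mul_of_one_le_of_one_le (Real.one_le_exp (by positivity))
      (Real.one_le_exp (by positivity))
  have hw0 : ∀ z, 0 < w z := fun z => by simp only [w]; positivity
  have hwc : Continuous w := by fun_prop
  let I : (ℝ × ℝ → ℝ) → ℝ × ℝ → ℝ := fun v z =>
    ∫ s in p..z.1, ∫ r in q..z.2, K s r * (w (s, r) * v (s, r))
  have hNc : ∀ v : ℝ × ℝ → ℝ, Continuous v →
      Continuous fun z : ℝ × ℝ => K z.1 z.2 * (w (z.1, z.2) * v (z.1, z.2)) := by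
    intro v hv
    exact hK.mul (hwc.mul hv)
  have hIc : ∀ v, Continuous v → Continuous (I v) := fun v hv =>
    (contDiff_succ_iterated_intervalIntegral (n := 0)
      (N := fun s r => K s r * (w (s, r) * v (s, r))) p q (contDiff_zero.2 (hNc v hv))).continuous
  have hIb : ∀ (v : ℝ × ℝ → ℝ) (M : ℝ), 0 ≤ M → (∀ z, |v z| ≤ M) →
      ∀ z, |I v z| ≤ C * M / L ^ 2 * w z := by
    intro v M hM hv z
    refine abs_iterated_integral_le (M := C * M) hL (by positivity) fun s _ r _ => ?_
    rw [abs_mul, abs_mul, abs_of_pos (hw0 _)]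
    calc |K s r| * (w (s, r) * |v (s, r)|) ≤ C * (w (s, r) * M) := by
          have := hw0 (s, r)
          gcongr
          · exact hC s r
          · exact hv _
      _ = _ := by simp only [w]; ring
  let T : BoundedContinuousFunction (ℝ × ℝ) ℝ → BoundedContinuousFunction (ℝ × ℝ) ℝ := fun v =>
    BoundedContinuousFunction.ofNormedAddCommGroup (fun z => (a z.1 z.2 + I v z) / w z)
      ((ha.add (hIc v v.continuous)).div hwc fun z => (hw0 z).ne') (D + C * ‖v‖ / L ^ 2) (by
        intro z
        rw [Real.norm_eq_abs, abs_div, abs_of_pos (hw0 z), div_le_iff₀ (hw0 z), add_mul]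
        refine (abs_add_le _ _).trans (add_le_add ?_ ?_)
        · exact (hD _ _).trans (le_mul_of_one_le_right hD0 (hw z))
        · exact hIb v ‖v‖ (norm_nonneg _) (fun z => v.norm_coe_le_norm z) z)
  have hθ : C / L ^ 2 < 1 := by
    rw [div_lt_one (by positivity), hLdef]; nlinarith
  have hT : ContractingWith (NNReal.mk (C / L ^ 2) (div_nonneg hC0 (sq_nonneg L))) T := by
    refine ⟨by exact_mod_cast hθ, LipschitzWith.of_dist_le_mul fun v v' => ?_⟩
    refine (BoundedContinuousFunction.dist_le
      (mul_nonneg (div_nonneg hC0 (sq_nonneg L)) dist_nonneg)).2 fun z => ?_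
    have e : I v z - I v' z = I (fun z => v z - v' z) z := by
      simp only [I]
      have ci : ∀ (v : BoundedContinuousFunction (ℝ × ℝ) ℝ), Continuous fun s : ℝ =>
          ∫ r in q..z.2, K s r * (w (s, r) * v (s, r)) := fun v =>
        (continuous_intervalIntegral_snd (N := fun s r => K s r * (w (s, r) * v (s, r))) q
          (hNc v v.continuous)).comp (by fun_prop : Continuous fun s : ℝ => (s, z.2))
      rw [← intervalIntegral.integral_sub ((ci v).intervalIntegrable _ _)
        ((ci v').intervalIntegrable _ _)]
      refine intervalIntegral.integral_congr fun s _ => ?_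
      have cr : ∀ (v : BoundedContinuousFunction (ℝ × ℝ) ℝ), Continuous fun r : ℝ =>
          K s r * (w (s, r) * v (s, r)) := fun v =>
        (hNc v v.continuous).comp (by fun_prop : Continuous fun r : ℝ => (s, r))
      rw [← intervalIntegral.integral_sub ((cr v).intervalIntegrable _ _)
        ((cr v').intervalIntegrable _ _)]
      refine intervalIntegral.integral_congr fun r _ => ?_
      ring
    have hb := hIb (fun z => v z - v' z) (dist v v') dist_nonneg
      (fun z => by rw [← Real.dist_eq]; exact BoundedContinuousFunction.dist_coe_le_dist z) z
    show |(a z.1 z.2 + I v z) / w z - (a z.1 z.2 + I v' z) / w z| ≤ C / L ^ 2 * dist v v'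
    rw [← sub_div, add_sub_add_left_eq_sub, e, abs_div, abs_of_pos (hw0 z), div_le_iff₀ (hw0 z)]
    calc _ ≤ _ := hb
      _ = _ := by ring
  let v := hT.fixedPoint T
  have hv : T v = v := hT.fixedPoint_isFixedPt
  refine ⟨fun x y => w (x, y) * v (x, y), ?_, ?_⟩
  · exact hwc.mul v.continuous
  · intro x y
    have h1 : (a x y + I v (x, y)) / w (x, y) = v (x, y) := congrArg (fun f => f (x, y)) hv
    change w (x, y) * v (x, y) = a x y + I v (x, y)
    rw [← h1, mul_div_cancel₀ _ (hw0 _).ne']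

/-- The fundamental theorem of calculus for a mixed second derivative on a rectangle. -/
theorem integral_mixed_deriv {p q x y : ℝ} {u v N : ℝ → ℝ → ℝ}
    (hv : ContinuousOn (fun z : ℝ × ℝ => v z.1 z.2) (uIcc p x ×ˢ uIcc q y))
    (hN : ContinuousOn (fun z : ℝ × ℝ => N z.1 z.2) (uIcc p x ×ˢ uIcc q y))
    (h₁ : ∀ s ∈ uIcc p x, ∀ r ∈ uIcc q y, HasDerivAt (fun s => u s r) (v s r) s)
    (h₂ : ∀ s ∈ uIcc p x, ∀ r ∈ uIcc q y, HasDerivAt (fun r => v s r) (N s r) r) :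
    ∫ s in p..x, ∫ r in q..y, N s r = u x y - u p y - (u x q - u p q) := by
  have hvr : ∀ r ∈ uIcc q y, IntervalIntegrable (fun s => v s r) volume p x := fun r hr =>
    (hv.comp (f := fun s : ℝ => ((s, r) : ℝ × ℝ)) (by fun_prop)
      fun s hs => ⟨hs, hr⟩).intervalIntegrable
  have inner : ∀ s ∈ uIcc p x, ∫ r in q..y, N s r = v s y - v s q := fun s hs =>
    intervalIntegral.integral_eq_sub_of_hasDerivAt (fun r hr => h₂ s hs r hr)
      (hN.comp (f := fun r : ℝ => ((s, r) : ℝ × ℝ)) (by fun_prop)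
        fun r hr => ⟨hs, hr⟩).intervalIntegrable
  rw [intervalIntegral.integral_congr inner,
    intervalIntegral.integral_sub (hvr y right_mem_uIcc) (hvr q left_mem_uIcc),
    intervalIntegral.integral_eq_sub_of_hasDerivAt (fun s hs => h₁ s hs y right_mem_uIcc)
      (hvr y right_mem_uIcc),
    intervalIntegral.integral_eq_sub_of_hasDerivAt (fun s hs => h₁ s hs q left_mem_uIcc)
      (hvr q left_mem_uIcc)]

end GoursatPicard

section InverseFunction

open Set Filter Topology

/-- A smooth function with negative derivative mapping an open interval onto the line has a
globally defined smooth inverse. -/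
theorem exists_contDiff_inverse {a b : ℝ} (hab : a < b) {h h' : ℝ → ℝ}
    (hd : ∀ t ∈ Ioo a b, HasDerivAt h (h' t) t) (hneg : ∀ t ∈ Ioo a b, h' t < 0)
    (hc : ∀ t ∈ Ioo a b, ContDiffAt ℝ (⊤ : ℕ∞) h t)
    (htop : Tendsto h (𝓝[>] a) atTop) (hbot : Tendsto h (𝓝[<] b) atBot) :
    ∃ T : ℝ → ℝ, ContDiff ℝ (⊤ : ℕ∞) T ∧ StrictAnti T ∧ (∀ z, T z ∈ Ioo a b) ∧
      (∀ z, h (T z) = z) ∧ (∀ t ∈ Ioo a b, T (h t) = t) ∧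
      ∀ z, HasDerivAt T (h' (T z))⁻¹ z := by
  have hcont : ContinuousOn h (Ioo a b) := fun t ht => (hd t ht).continuousAt.continuousWithinAt
  have hanti : StrictAntiOn h (Ioo a b) := by
    refine strictAntiOn_of_deriv_neg (convex_Ioo a b) hcont fun t ht => ?_
    rw [interior_Ioo] at ht
    rw [(hd t ht).deriv]; exact hneg t ht
  have hsurj : ∀ z, ∃ t ∈ Ioo a b, h t = z := by
    intro z
    obtain ⟨c, hcz, hca⟩ := ((htop.eventually (eventually_ge_atTop z)).and
      (Ioo_mem_nhdsGT hab)).exists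
    obtain ⟨d, hdz, hdb⟩ := ((hbot.eventually (eventually_lt_atBot z)).and
      (Ioo_mem_nhdsLT hab)).exists
    have hcd : c ≤ d := by
      by_contra hlt
      push Not at hlt
      have := hanti hdb hca hlt
      linarith
    have hsub : Icc c d ⊆ Ioo a b := fun t ht => ⟨hca.1.trans_le ht.1, ht.2.trans_lt hdb.2⟩
    obtain ⟨t, ht, e⟩ := intermediate_value_Icc' hcd (hcont.mono hsub) ⟨hdz.le, hcz⟩
    exact ⟨t, hsub ht, e⟩
  choose T hT hhT using hsurj
  have hTh : ∀ t ∈ Ioo a b, T (h t) = t := fun t ht => hanti.injOn (hT _) ht (hhT _)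
  have hTanti : StrictAnti T := by
    intro x y hxy
    by_contra hle
    push Not at hle
    have := hanti.antitoneOn (hT x) (hT y) hle
    rw [hhT, hhT] at this
    linarith
  have hloc : ∀ z, ContDiffAt ℝ (⊤ : ℕ∞) T z := by
    intro z
    have hne : h' (T z) ≠ 0 := (hneg _ (hT z)).ne
    have hn : ((⊤ : ℕ∞) : WithTop ℕ∞) ≠ 0 := by simp
    let f' : ℝ ≃L[ℝ] ℝ := ContinuousLinearEquiv.unitsEquivAut ℝ (Units.mk0 _ hne)
    have hf' : HasFDerivAt h (f' : ℝ →L[ℝ] ℝ) (T z) := by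
      refine (hd _ (hT z)).hasFDerivAt.congr_fderiv ?_
      ext; simp [f']
    have hg := (hc _ (hT z)).to_localInverse hf' hn
    rw [hhT] at hg
    refine hg.congr_of_eventuallyEq ?_
    have hst : HasStrictFDerivAt h (f' : ℝ →L[ℝ] ℝ) (T z) :=
      (hc _ (hT z)).hasStrictFDerivAt' hf' hn
    have h1 : ∀ᶠ y in 𝓝 z, h (hst.localInverse h f' (T z) y) = y := by
      have := hst.eventually_right_inverse
      rwa [hhT] at this
    have hgz : hst.localInverse h f' (T z) z = T z := by
      have := hst.localInverse_apply_image
      rwa [hhT] at this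
    have h2 : ∀ᶠ y in 𝓝 z, hst.localInverse h f' (T z) y ∈ Ioo a b := by
      have hcg : ContinuousAt (hst.localInverse h f' (T z)) z := by
        have := hst.localInverse_continuousAt
        rwa [hhT] at this
      exact hcg.eventually (by rw [hgz]; exact isOpen_Ioo.mem_nhds (hT z))
    filter_upwards [h1, h2] with y hy1 hy2
    exact hanti.injOn (hT y) hy2 ((hhT y).trans hy1.symm)
  refine ⟨T, contDiff_iff_contDiffAt.2 hloc, hTanti, hT, hhT, hTh, fun z => ?_⟩
  exact HasDerivAt.of_local_left_inverse (hloc z).continuousAt (hd _ (hT z)) (hneg _ (hT z)).ne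
    (Eventually.of_forall hhT)

/-- The Cauchy horizon time function: `T` inverts
`t ↦ (t₁ - t)(t₂ - t)^p t^(-q)`, the value of `X / Y^q` in self-similar Vaidya spacetime. -/
theorem exists_vaidya_time {lam t₁ t₂ p q : ℝ} (h1 : 0 < t₁) (h12 : t₁ < t₂)
    (hprod : lam * (t₁ * t₂) = 1) (hsum : 2 * lam * (t₁ + t₂) = 1) (hq : q = 1 + p)
    (hp : t₁ + p * t₂ = 0) :
    ∃ T : ℝ → ℝ, ContDiff ℝ (⊤ : ℕ∞) T ∧ StrictAnti T ∧ (∀ z, T z ∈ Ioo 0 t₂) ∧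
      (∀ t ∈ Ioo 0 t₂, T ((t₁ - t) * (t₂ - t) ^ p * t ^ (-q)) = t) ∧
      ∀ z, q * (z * deriv T z) = -(T z * (1 - T z / 2 + lam * T z ^ 2)) := by
  have h2 : 0 < t₂ := h1.trans h12
  have hp' : p = -(t₁ / t₂) := by field_simp; linarith
  have hpneg : p < 0 := by rw [hp']; exact neg_neg_of_pos (by positivity)
  have hq0 : 0 < q := by
    have : t₁ / t₂ < 1 := (div_lt_one h2).2 h12
    rw [hq, hp']; linarith
  let h : ℝ → ℝ := fun t => (t₁ - t) * (t₂ - t) ^ p * t ^ (-q)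
  let h' : ℝ → ℝ := fun t => -(q * (t₁ * t₂) * (t₂ - t) ^ (p - 1) * t ^ (-q - 1))
  have split : ∀ t ∈ Ioo 0 t₂, (t₂ - t) ^ p = (t₂ - t) ^ (p - 1) * (t₂ - t) ∧
      t ^ (-q) = t ^ (-q - 1) * t := by
    intro t ht
    have a1 : t₂ - t ≠ 0 := by linarith [ht.2]
    have a2 : t ≠ 0 := ht.1.ne'
    constructor
    · rw [Real.rpow_sub_one a1]; field_simp
    · rw [Real.rpow_sub_one a2]; field_simp
  have hd : ∀ t ∈ Ioo 0 t₂, HasDerivAt h (h' t) t := by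
    intro t ht
    have a1 : t₂ - t ≠ 0 := by linarith [ht.2]
    have a2 : t ≠ 0 := ht.1.ne'
    have d1 : HasDerivAt (fun t => t₁ - t) (-1) t := by
      simpa using (hasDerivAt_id t).const_sub t₁
    have d2 : HasDerivAt (fun t => t₂ - t) (-1) t := by
      simpa using (hasDerivAt_id t).const_sub t₂
    have := (d1.mul (d2.rpow_const (p := p) (Or.inl a1))).mul
      ((hasDerivAt_id t).rpow_const (p := -q) (Or.inl a2))
    refine this.congr_deriv ?_
    obtain ⟨e1, e2⟩ := split t ht
    simp only [h', id, Pi.mul_apply]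
    rw [e1, e2]
    have ht1 : t₁ = -(p * t₂) := by linarith
    rw [ht1, hq]
    ring
  have hneg : ∀ t ∈ Ioo 0 t₂, h' t < 0 := by
    intro t ht
    have a1 : 0 < t₂ - t := by linarith [ht.2]
    have a2 := ht.1
    simp only [h']
    exact neg_neg_of_pos (by positivity)
  have hc : ∀ t ∈ Ioo 0 t₂, ContDiffAt ℝ (⊤ : ℕ∞) h t := by
    intro t ht
    have a1 : t₂ - t ≠ 0 := by linarith [ht.2]
    have a2 : t ≠ 0 := ht.1.ne'
    exact ((contDiffAt_const.sub contDiffAt_id).mul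
      (ContDiffAt.rpow_const_of_ne (contDiffAt_const.sub contDiffAt_id) a1)).mul
      (ContDiffAt.rpow_const_of_ne contDiffAt_id a2)
  have htop : Tendsto h (𝓝[>] 0) atTop := by
    have f1 : Tendsto (fun t : ℝ => (t₁ - t) * (t₂ - t) ^ p) (𝓝[>] 0) (𝓝 ((t₁ - 0) * (t₂ - 0) ^ p)) := by
      have : ContinuousAt (fun t : ℝ => (t₁ - t) * (t₂ - t) ^ p) 0 := by
        refine ContinuousAt.mul (by fun_prop) (ContinuousAt.rpow_const (by fun_prop) ?_)
        left; simpa using h2.ne'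
      exact this.tendsto.mono_left nhdsWithin_le_nhds
    refine f1.pos_mul_atTop (by simp only [sub_zero]; positivity) ?_
    exact tendsto_rpow_neg_nhdsGT_zero (by linarith)
  have hbot : Tendsto h (𝓝[<] t₂) atBot := by
    have f1 : Tendsto (fun t : ℝ => (t₁ - t) * t ^ (-q)) (𝓝[<] t₂) (𝓝 ((t₁ - t₂) * t₂ ^ (-q))) := by
      have : ContinuousAt (fun t : ℝ => (t₁ - t) * t ^ (-q)) t₂ := by
        refine ContinuousAt.mul (by fun_prop) (ContinuousAt.rpow_const (by fun_prop) ?_)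
        left; exact h2.ne'
      exact this.tendsto.mono_left nhdsWithin_le_nhds
    have f2 : Tendsto (fun t : ℝ => (t₂ - t) ^ p) (𝓝[<] t₂) atTop := by
      have g1 : Tendsto (fun t : ℝ => t₂ - t) (𝓝[<] t₂) (𝓝[>] 0) := by
        refine tendsto_nhdsWithin_iff.2 ⟨?_, ?_⟩
        · have : ContinuousAt (fun t : ℝ => t₂ - t) t₂ := by fun_prop
          simpa [ContinuousAt] using this.tendsto.mono_left nhdsWithin_le_nhds
        · filter_upwards [self_mem_nhdsWithin] with t ht
          simpa using ht
      exact (tendsto_rpow_neg_nhdsGT_zero hpneg).comp g1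
    have := f1.neg_mul_atTop
      (mul_neg_of_neg_of_pos (by linarith) (by positivity)) f2
    refine this.congr fun t => ?_
    simp only [h]; ring
  obtain ⟨T, c, anti, mem, r, l, d⟩ := exists_contDiff_inverse h2 hd hneg hc htop hbot
  refine ⟨T, c, anti, mem, l, fun z => ?_⟩
  rw [(d z).deriv]
  have hz : z = h (T z) := (r z).symm
  have ht := mem z
  generalize T z = t at hz ht ⊢
  obtain ⟨e1, e2⟩ := split t ht
  have a1 : 0 < t₂ - t := by linarith [ht.2]
  have a2 := ht.1
  rw [hz]
  simp only [h, h']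
  rw [e1, e2]
  have : 0 < (t₂ - t) ^ (p - 1) := by positivity
  have : 0 < t ^ (-q - 1) := by positivity
  have e3 : 1 - t / 2 + lam * t ^ 2 = lam * ((t₁ - t) * (t₂ - t)) := by linear_combination -hprod + t/2 * hsum
  rw [e3]
  have e4 : lam = 1 / (t₁ * t₂) := by field_simp; linarith
  rw [e4]
  field_simp

end InverseFunction

section CharacteristicCoordinates

open Set Filter Topology

theorem ptD_eq_fderiv {F : ℝ → ℝ → ℝ} {O : Set (ℝ × ℝ)} (hO : IsOpen O)
    (hF : ContDiffOn ℝ (⊤ : ℕ∞) (fun z : ℝ × ℝ => F z.1 z.2) O) {z : ℝ × ℝ} (hz : z ∈ O) :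
    ptD F z.1 z.2 = fderiv ℝ (fun z : ℝ × ℝ => F z.1 z.2) z (1, 0) := by
  have hd := ((hF.contDiffAt (hO.mem_nhds hz)).differentiableAt (by simp)).hasFDerivAt
  exact (hd.comp_hasDerivAt z.1 ((hasDerivAt_id z.1).prodMk (hasDerivAt_const _ z.2))).deriv

theorem pxD_eq_fderiv {F : ℝ → ℝ → ℝ} {O : Set (ℝ × ℝ)} (hO : IsOpen O)
    (hF : ContDiffOn ℝ (⊤ : ℕ∞) (fun z : ℝ × ℝ => F z.1 z.2) O) {z : ℝ × ℝ} (hz : z ∈ O) :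
    pxD F z.1 z.2 = fderiv ℝ (fun z : ℝ × ℝ => F z.1 z.2) z (0, 1) := by
  have hd := ((hF.contDiffAt (hO.mem_nhds hz)).differentiableAt (by simp)).hasFDerivAt
  exact (hd.comp_hasDerivAt z.2 ((hasDerivAt_const _ z.1).prodMk (hasDerivAt_id z.2))).deriv

theorem hasDerivAt_comp_partials {F : ℝ → ℝ → ℝ} {O : Set (ℝ × ℝ)} (hO : IsOpen O)
    (hF : ContDiffOn ℝ (⊤ : ℕ∞) (fun z : ℝ × ℝ => F z.1 z.2) O) {τ ξ : ℝ → ℝ} {τ' ξ' σ : ℝ}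
    (hτ : HasDerivAt τ τ' σ) (hξ : HasDerivAt ξ ξ' σ) (hm : (τ σ, ξ σ) ∈ O) :
    HasDerivAt (fun s => F (τ s) (ξ s)) (ptD F (τ σ) (ξ σ) * τ' + pxD F (τ σ) (ξ σ) * ξ') σ := by
  have hd : HasFDerivAt (fun z : ℝ × ℝ => F z.1 z.2)
      (fderiv ℝ (fun z : ℝ × ℝ => F z.1 z.2) (τ σ, ξ σ)) (τ σ, ξ σ) :=
    ((hF.contDiffAt (hO.mem_nhds hm)).differentiableAt (by simp)).hasFDerivAt
  set L := fderiv ℝ (fun z : ℝ × ℝ => F z.1 z.2) (τ σ, ξ σ)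
  have e1 : ptD F (τ σ) (ξ σ) = L (1, 0) := ptD_eq_fderiv hO hF hm
  have e2 : pxD F (τ σ) (ξ σ) = L (0, 1) := pxD_eq_fderiv hO hF hm
  refine (hd.comp_hasDerivAt σ (hτ.prodMk hξ)).congr_deriv ?_
  rw [e1, e2]
  have : ((τ', ξ') : ℝ × ℝ) = τ' • ((1, 0) : ℝ × ℝ) + ξ' • ((0, 1) : ℝ × ℝ) := by simp
  rw [this, map_add, map_smul, map_smul]
  simp only [smul_eq_mul]; ring

theorem contDiffOn_ptD {F : ℝ → ℝ → ℝ} {O : Set (ℝ × ℝ)} (hO : IsOpen O)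
    (hF : ContDiffOn ℝ (⊤ : ℕ∞) (fun z : ℝ × ℝ => F z.1 z.2) O) :
    ContDiffOn ℝ (⊤ : ℕ∞) (fun z : ℝ × ℝ => ptD F z.1 z.2) O :=
  ((hF.fderiv_of_isOpen hO (m := (⊤ : ℕ∞)) (by simp)).clm_apply
    contDiffOn_const).congr fun _ hz => ptD_eq_fderiv hO hF hz

theorem contDiffOn_pxD {F : ℝ → ℝ → ℝ} {O : Set (ℝ × ℝ)} (hO : IsOpen O)
    (hF : ContDiffOn ℝ (⊤ : ℕ∞) (fun z : ℝ × ℝ => F z.1 z.2) O) :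
    ContDiffOn ℝ (⊤ : ℕ∞) (fun z : ℝ × ℝ => pxD F z.1 z.2) O :=
  ((hF.fderiv_of_isOpen hO (m := (⊤ : ℕ∞)) (by simp)).clm_apply
    contDiffOn_const).congr fun _ hz => pxD_eq_fderiv hO hF hz

theorem pxD_ptD_eq_ptD_pxD {F : ℝ → ℝ → ℝ} {O : Set (ℝ × ℝ)} (hO : IsOpen O)
    (hF : ContDiffOn ℝ (⊤ : ℕ∞) (fun z : ℝ × ℝ => F z.1 z.2) O) {z : ℝ × ℝ} (hz : z ∈ O) :
    pxD (ptD F) z.1 z.2 = ptD (pxD F) z.1 z.2 := by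
  have hc := hF.contDiffAt (hO.mem_nhds hz)
  have hs : IsSymmSndFDerivAt ℝ (fun z : ℝ × ℝ => F z.1 z.2) z :=
    hc.isSymmSndFDerivAt (by simp only [minSmoothness_of_isRCLikeNormedField]; exact WithTop.coe_le_coe.2 le_top)
  have hdd : DifferentiableAt ℝ (fderiv ℝ (fun z : ℝ × ℝ => F z.1 z.2)) z :=
    (hc.fderiv_right (m := 1) (by norm_cast)).differentiableAt (by simp)
  have e : ∀ v w : ℝ × ℝ, fderiv ℝ (fun z' => fderiv ℝ (fun z : ℝ × ℝ => F z.1 z.2) z' v) z w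
      = fderiv ℝ (fderiv ℝ (fun z : ℝ × ℝ => F z.1 z.2)) z w v := by
    intro v w
    rw [fderiv_clm_apply hdd (differentiableAt_const v)]
    simp
  rw [pxD_eq_fderiv hO (contDiffOn_ptD hO hF) hz, ptD_eq_fderiv hO (contDiffOn_pxD hO hF) hz]
  have c1 : (fun z : ℝ × ℝ => ptD F z.1 z.2) =ᶠ[𝓝 z]
      fun z' => fderiv ℝ (fun z : ℝ × ℝ => F z.1 z.2) z' (1, 0) := by
    filter_upwards [hO.mem_nhds hz] with z' hz' using ptD_eq_fderiv hO hF hz'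
  have c2 : (fun z : ℝ × ℝ => pxD F z.1 z.2) =ᶠ[𝓝 z]
      fun z' => fderiv ℝ (fun z : ℝ × ℝ => F z.1 z.2) z' (0, 1) := by
    filter_upwards [hO.mem_nhds hz] with z' hz' using pxD_eq_fderiv hO hF hz'
  rw [c1.fderiv_eq, c2.fderiv_eq, e, e]
  exact hs _ _

/-- The field `e^{3x} φ(t,x)` in the coordinates `(X, y)`, `y = log Y = x + log t`, where
`t = T (X e^{-q y})`. -/
noncomputable def charField (T : ℝ → ℝ) (q : ℝ) (φ : ℝ → ℝ → ℝ) (X y : ℝ) : ℝ :=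
  Real.exp (3 * (y - Real.log (T (X * Real.exp (-q * y)))))
    * φ (T (X * Real.exp (-q * y))) (y - Real.log (T (X * Real.exp (-q * y))))

/-- The `X`-derivative of `charField`. -/
noncomputable def charFieldX (T : ℝ → ℝ) (q : ℝ) (φ : ℝ → ℝ → ℝ) (X y : ℝ) : ℝ :=
  Real.exp (3 * (y - Real.log (T (X * Real.exp (-q * y)))))
    * (ptD φ (T (X * Real.exp (-q * y))) (y - Real.log (T (X * Real.exp (-q * y))))
      - (pxD φ (T (X * Real.exp (-q * y))) (y - Real.log (T (X * Real.exp (-q * y))))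
        + 3 * φ (T (X * Real.exp (-q * y))) (y - Real.log (T (X * Real.exp (-q * y)))))
          / T (X * Real.exp (-q * y)))
    * (deriv T (X * Real.exp (-q * y)) * Real.exp (-q * y))

/-- The potential of the master equation in the coordinates `(X, y)`. -/
noncomputable def charPotential (T : ℝ → ℝ) (q lam ell X y : ℝ) : ℝ :=
  1 / 2 * (deriv T (X * Real.exp (-q * y)) * Real.exp (-q * y))
    * (-2 + 6 * lam * T (X * Real.exp (-q * y)) - ell)

/-- The source of the master equation in the coordinates `(X, y)`. -/
noncomputable def charSource (T : ℝ → ℝ) (q lam : ℝ) (μ₀ : ℝ → ℝ) (X y : ℝ) : ℝ :=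
  -(4 * lam * (deriv T (X * Real.exp (-q * y)) * Real.exp (-q * y)) * μ₀ (Real.exp y))

variable {T : ℝ → ℝ} {q lam ell : ℝ} {μ₀ : ℝ → ℝ} {φ : ℝ → ℝ → ℝ} {O : Set (ℝ × ℝ)}

theorem contDiff_deriv_of_contDiff_top (hT : ContDiff ℝ (⊤ : ℕ∞) T) :
    ContDiff ℝ (⊤ : ℕ∞) (deriv T) :=
  (contDiff_infty_iff_deriv.1 hT).2

theorem contDiff_charPotential (hT : ContDiff ℝ (⊤ : ℕ∞) T) :
    ContDiff ℝ (⊤ : ℕ∞) (fun z : ℝ × ℝ => charPotential T q lam ell z.1 z.2) := by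
  have hT' := contDiff_deriv_of_contDiff_top hT
  unfold charPotential
  fun_prop

theorem contDiff_charSource (hT : ContDiff ℝ (⊤ : ℕ∞) T) (hμ : ContDiff ℝ (⊤ : ℕ∞) μ₀) :
    ContDiff ℝ (⊤ : ℕ∞) (fun z : ℝ × ℝ => charSource T q lam μ₀ z.1 z.2) := by
  have hT' := contDiff_deriv_of_contDiff_top hT
  unfold charSource
  fun_prop

theorem contDiff_charCoords (hT : ContDiff ℝ (⊤ : ℕ∞) T) (hpos : ∀ z, 0 < T z) :
    ContDiff ℝ (⊤ : ℕ∞) (fun z : ℝ × ℝ => ((T (z.1 * Real.exp (-q * z.2)),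
      z.2 - Real.log (T (z.1 * Real.exp (-q * z.2)))) : ℝ × ℝ)) := by
  have h : ContDiff ℝ (⊤ : ℕ∞) (fun z : ℝ × ℝ => T (z.1 * Real.exp (-q * z.2))) := by fun_prop
  exact h.prodMk (contDiff_snd.sub (h.log fun z => (hpos _).ne'))

theorem contDiffOn_charField (hO : IsOpen O)
    (hφ : ContDiffOn ℝ (⊤ : ℕ∞) (fun z : ℝ × ℝ => φ z.1 z.2) O)
    (hT : ContDiff ℝ (⊤ : ℕ∞) T) (hpos : ∀ z, 0 < T z) :
    ContDiffOn ℝ (⊤ : ℕ∞) (fun z : ℝ × ℝ => charField T q φ z.1 z.2)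
      {z | (T (z.1 * Real.exp (-q * z.2)), z.2 - Real.log (T (z.1 * Real.exp (-q * z.2)))) ∈ O} ∧
    ContDiffOn ℝ (⊤ : ℕ∞) (fun z : ℝ × ℝ => charFieldX T q φ z.1 z.2)
      {z | (T (z.1 * Real.exp (-q * z.2)), z.2 - Real.log (T (z.1 * Real.exp (-q * z.2)))) ∈ O} := by
  have hT' := contDiff_deriv_of_contDiff_top hT
  have hc := contDiff_charCoords (q := q) hT hpos
  have h1 : ContDiff ℝ (⊤ : ℕ∞) (fun z : ℝ × ℝ => T (z.1 * Real.exp (-q * z.2))) := by fun_prop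
  have h2 : ContDiff ℝ (⊤ : ℕ∞) (fun z : ℝ × ℝ =>
      deriv T (z.1 * Real.exp (-q * z.2)) * Real.exp (-q * z.2)) := by fun_prop
  have hE : ContDiff ℝ (⊤ : ℕ∞) (fun z : ℝ × ℝ =>
      Real.exp (3 * (z.2 - Real.log (T (z.1 * Real.exp (-q * z.2)))))) :=
    (contDiff_const.mul hc.snd).exp
  have hm : MapsTo (fun z : ℝ × ℝ => ((T (z.1 * Real.exp (-q * z.2)),
      z.2 - Real.log (T (z.1 * Real.exp (-q * z.2)))) : ℝ × ℝ))
      {z | (T (z.1 * Real.exp (-q * z.2)), z.2 - Real.log (T (z.1 * Real.exp (-q * z.2)))) ∈ O} O :=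
    fun z hz => hz
  have g0 := hφ.comp hc.contDiffOn hm
  have g1 := (contDiffOn_ptD hO hφ).comp hc.contDiffOn hm
  have g2 := (contDiffOn_pxD hO hφ).comp hc.contDiffOn hm
  refine ⟨hE.contDiffOn.mul g0, (hE.contDiffOn.mul (g1.sub ((g2.add
    (contDiffOn_const.mul g0)).div h1.contDiffOn fun z _ => (hpos _).ne'))).mul h2.contDiffOn⟩

theorem hasDerivAt_charField_fst (hO : IsOpen O)
    (hφ : ContDiffOn ℝ (⊤ : ℕ∞) (fun z : ℝ × ℝ => φ z.1 z.2) O)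
    (hT : ContDiff ℝ (⊤ : ℕ∞) T) (hpos : ∀ z, 0 < T z) {X y : ℝ}
    (hm : (T (X * Real.exp (-q * y)), y - Real.log (T (X * Real.exp (-q * y)))) ∈ O) :
    HasDerivAt (fun s => charField T q φ s y) (charFieldX T q φ X y) X := by
  have d0 : HasDerivAt (fun s => s * Real.exp (-q * y)) (Real.exp (-q * y)) X := by
    simpa using (hasDerivAt_id X).mul_const (Real.exp (-q * y))
  have dt : HasDerivAt (fun s => T (s * Real.exp (-q * y)))
      (deriv T (X * Real.exp (-q * y)) * Real.exp (-q * y)) X :=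
    ((hT.differentiable (by simp)).differentiableAt.hasDerivAt).comp X d0
  have dx : HasDerivAt (fun s => y - Real.log (T (s * Real.exp (-q * y)))) _ X :=
    (dt.log (hpos _).ne').const_sub y
  have dφ := hasDerivAt_comp_partials hO hφ dt dx hm
  have dE : HasDerivAt (fun s => Real.exp (3 * (y - Real.log (T (s * Real.exp (-q * y)))))) _ X :=
    (dx.const_mul 3).exp
  refine (dE.mul dφ).congr_deriv ?_
  unfold charFieldX
  have := (hpos (X * Real.exp (-q * y))).ne'
  field_simp
  ring

theorem hasDerivAt_charFieldX_snd (hO : IsOpen O)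
    (hφ : ContDiffOn ℝ (⊤ : ℕ∞) (fun z : ℝ × ℝ => φ z.1 z.2) O)
    (hT : ContDiff ℝ (⊤ : ℕ∞) T) (hpos : ∀ z, 0 < T z)
    (hrel : ∀ z, q * (z * deriv T z) = -(T z * (1 - T z / 2 + lam * T z ^ 2))) {X y : ℝ}
    (hm : (T (X * Real.exp (-q * y)), y - Real.log (T (X * Real.exp (-q * y)))) ∈ O)
    (heq : MasterEqAt lam ell 0 μ₀ φ (T (X * Real.exp (-q * y)))
      (y - Real.log (T (X * Real.exp (-q * y))))) :
    HasDerivAt (fun r => charFieldX T q φ X r)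
      (charPotential T q lam ell X y * charField T q φ X y + charSource T q lam μ₀ X y) y := by
  have hT' := contDiff_deriv_of_contDiff_top hT
  have dT : ∀ z, HasDerivAt T (deriv T z) z := fun z =>
    (hT.differentiable (by simp)).differentiableAt.hasDerivAt
  have dT' : ∀ z, HasDerivAt (deriv T) (deriv (deriv T) z) z := fun z =>
    (hT'.differentiable (by simp)).differentiableAt.hasDerivAt
  have hrel' : ∀ z, q * (deriv T z + z * deriv (deriv T) z)
      = -((1 - T z + 3 * lam * T z ^ 2) * deriv T z) := by
    intro z
    have l : HasDerivAt (fun z => q * (z * deriv T z))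
        (q * (1 * deriv T z + z * deriv (deriv T) z)) z :=
      ((hasDerivAt_id z).mul (dT' z)).const_mul q
    have r := ((dT z).mul ((((dT z).div_const 2).const_sub 1).add
      (((dT z).pow 2).const_mul lam))).neg
    have hfun : (fun z => q * (z * deriv T z)) = -(T * ((fun x => 1 - T x / 2) + fun y => lam * (T ^ 2) y)) := by
      funext z; simpa using hrel z
    rw [hfun] at l
    have := l.unique r
    simp at this
    linear_combination this
  have d0 : HasDerivAt (fun r => X * Real.exp (-q * r)) (X * (Real.exp (-q * y) * -q)) y := by
    simpa using (((hasDerivAt_id y).const_mul (-q)).exp).const_mul X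
  have dexp : HasDerivAt (fun r => Real.exp (-q * r)) (Real.exp (-q * y) * -q) y := by
    simpa using ((hasDerivAt_id y).const_mul (-q)).exp
  have dt : HasDerivAt (fun r => T (X * Real.exp (-q * r)))
      (T (X * Real.exp (-q * y)) * (1 - T (X * Real.exp (-q * y)) / 2
        + lam * T (X * Real.exp (-q * y)) ^ 2)) y := by
    refine ((dT _).comp y d0).congr_deriv ?_
    linear_combination (-1 : ℝ) * hrel (X * Real.exp (-q * y))
  have dw : HasDerivAt (fun r => deriv T (X * Real.exp (-q * r)) * Real.exp (-q * r))
      ((1 - T (X * Real.exp (-q * y)) + 3 * lam * T (X * Real.exp (-q * y)) ^ 2)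
        * (deriv T (X * Real.exp (-q * y)) * Real.exp (-q * y))) y := by
    refine (((dT' _).comp y d0).mul dexp).congr_deriv ?_
    simp only [Function.comp]
    linear_combination (-Real.exp (-q * y)) * hrel' (X * Real.exp (-q * y))
  have dx : HasDerivAt (fun r => r - Real.log (T (X * Real.exp (-q * r)))) _ y :=
    (hasDerivAt_id y).sub (dt.log (hpos _).ne')
  have dE : HasDerivAt (fun r => Real.exp (3 * (r - Real.log (T (X * Real.exp (-q * r)))))) _ y :=
    (dx.const_mul 3).exp
  have dφ := hasDerivAt_comp_partials hO hφ dt dx hm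
  have dφt := hasDerivAt_comp_partials hO (contDiffOn_ptD hO hφ) dt dx hm
  have dφx := hasDerivAt_comp_partials hO (contDiffOn_pxD hO hφ) dt dx hm
  have hsymm := pxD_ptD_eq_ptD_pxD hO hφ hm
  refine ((dE.mul (dφt.sub ((dφx.add (dφ.const_mul 3)).div dt (hpos _).ne'))).mul dw).congr_deriv ?_
  unfold charPotential charSource charField
  unfold MasterEqAt at heq
  have hY : T (X * Real.exp (-q * y)) * Real.exp (y - Real.log (T (X * Real.exp (-q * y))))
      = Real.exp y := by
    rw [Real.exp_sub, Real.exp_log (hpos _)]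
    exact mul_div_cancel₀ _ (hpos _).ne'
  rw [hY] at heq
  have hE : Real.exp (3 * (y - Real.log (T (X * Real.exp (-q * y)))))
      * Real.exp ((0 - 3) * (y - Real.log (T (X * Real.exp (-q * y))))) = 1 := by
    rw [← Real.exp_add]; ring_nf; exact Real.exp_zero
  have hTp := (hpos (X * Real.exp (-q * y))).ne'
  simp only [Pi.mul_apply, Pi.sub_apply, Pi.add_apply, Pi.div_apply] at hsymm ⊢
  rw [hsymm]
  generalize deriv T (X * Real.exp (-q * y)) * Real.exp (-q * y) = w
  generalize Real.exp (3 * (y - Real.log (T (X * Real.exp (-q * y))))) = E at *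
  generalize Real.exp ((0 - 3) * (y - Real.log (T (X * Real.exp (-q * y))))) = E' at *
  generalize ptD (ptD φ) (T (X * Real.exp (-q * y))) (y - Real.log (T (X * Real.exp (-q * y)))) = φtt at *
  generalize ptD (pxD φ) (T (X * Real.exp (-q * y))) (y - Real.log (T (X * Real.exp (-q * y)))) = φtx at *
  generalize pxD (pxD φ) (T (X * Real.exp (-q * y))) (y - Real.log (T (X * Real.exp (-q * y)))) = φxx at *
  generalize ptD φ (T (X * Real.exp (-q * y))) (y - Real.log (T (X * Real.exp (-q * y)))) = φt at *
  generalize pxD φ (T (X * Real.exp (-q * y))) (y - Real.log (T (X * Real.exp (-q * y)))) = φx at *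
  generalize φ (T (X * Real.exp (-q * y))) (y - Real.log (T (X * Real.exp (-q * y)))) = φ0 at *
  generalize μ₀ (Real.exp y) = m at *
  generalize T (X * Real.exp (-q * y)) = t at *
  field_simp
  linear_combination (-E * w * t) * heq - 8 * lam * w * t * m * hE

end CharacteristicCoordinates

section CompactSupport

open Set Filter Topology

theorem exists_Ioo_forall_lt_eq_zero {a b : ℝ} (hab : a < b) {φ : ℝ → ℝ → ℝ}
    (hφ : ContinuousOn (fun z : ℝ × ℝ => φ z.1 z.2) (Icc a b ×ˢ univ))
    (hc : ∀ t ∈ Icc a b, HasCompactSupport (fun x => φ t x)) :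
    ∃ c d m : ℝ, a < c ∧ c < d ∧ d < b ∧ ∀ t ∈ Ioo c d, ∀ x < m, φ t x = 0 := by
  have hmem : ∀ t, max a (min b t) ∈ Icc a b := fun t =>
    ⟨le_max_left _ _, max_le hab.le (min_le_left _ _)⟩
  have hψ : ∀ x, Continuous (fun t => φ (max a (min b t)) x) := fun x =>
    hφ.comp_continuous (f := fun t => ((max a (min b t), x) : ℝ × ℝ)) (by fun_prop)
      fun t => ⟨hmem t, mem_univ _⟩
  let Z : ℕ → Set ℝ := fun n => {t | ∀ x < -(n : ℝ), φ (max a (min b t)) x = 0}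
  have hZ : ∀ n, IsClosed (Z n) := by
    intro n
    have : Z n = ⋂ x : ℝ, ⋂ _ : x < -(n : ℝ), {t | φ (max a (min b t)) x = 0} := by
      ext t; simp [Z]
    rw [this]
    exact isClosed_iInter fun x => isClosed_iInter fun _ => isClosed_eq (hψ x) continuous_const
  have hU : ⋃ n, Z n = univ := by
    refine eq_univ_of_forall fun t => ?_
    obtain ⟨R, hR⟩ := (hc _ (hmem t)).isBounded.subset_closedBall 0
    obtain ⟨n, hn⟩ := exists_nat_gt R
    refine mem_iUnion.2 ⟨n, fun x hx => ?_⟩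
    by_contra hne
    have := hR (subset_tsupport _ hne)
    rw [mem_closedBall_zero_iff, Real.norm_eq_abs] at this
    linarith [neg_abs_le x]
  obtain ⟨t, ht, ht'⟩ := (dense_iUnion_interior_of_closed hZ hU).exists_mem_open isOpen_Ioo
    (nonempty_Ioo.2 hab)
  obtain ⟨n, hn⟩ := mem_iUnion.1 ht
  obtain ⟨c, d, hcd, hs⟩ := mem_nhds_iff_exists_Ioo_subset.1
    ((isOpen_interior.inter isOpen_Ioo).mem_nhds (show t ∈ interior (Z n) ∩ Ioo a b from ⟨hn, ht'⟩))
  obtain ⟨c', hc1, hc2⟩ := exists_between hcd.1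
  obtain ⟨d', hd1, hd2⟩ := exists_between hcd.2
  have hc' := (hs (show c' ∈ Ioo c d from ⟨hc1, hc2.trans hcd.2⟩)).2
  have hd' := (hs (show d' ∈ Ioo c d from ⟨hcd.1.trans hd1, hd2⟩)).2
  refine ⟨c', d', -n, hc'.1, hc2.trans hd1, hd'.2, fun s hs' x hx => ?_⟩
  have h := hs (show s ∈ Ioo c d from ⟨hc1.trans hs'.1, hs'.2.trans hd2⟩)
  have := interior_subset h.1 x hx
  rwa [min_eq_right h.2.2.le, max_eq_right h.2.1.le] at this

theorem source_eq_zero_of_field_eq_zero {lam ell : ℝ} (hlam : lam ≠ 0) {μ₀ : ℝ → ℝ}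
    {φ : ℝ → ℝ → ℝ} {W : Set (ℝ × ℝ)} (hW : IsOpen W) (h0 : ∀ z ∈ W, φ z.1 z.2 = 0) {t x : ℝ}
    (hz : (t, x) ∈ W) (heq : MasterEqAt lam ell 0 μ₀ φ t x) : μ₀ (t * Real.exp x) = 0 := by
  have key : ∀ F : ℝ → ℝ → ℝ, (∀ z ∈ W, F z.1 z.2 = 0) →
      (∀ z ∈ W, ptD F z.1 z.2 = 0) ∧ ∀ z ∈ W, pxD F z.1 z.2 = 0 := by
    intro F hF
    constructor
    · rintro ⟨s, r⟩ hs
      have : (fun s' => F s' r) =ᶠ[𝓝 s] fun _ => 0 := by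
        have hc : Continuous fun s' : ℝ => ((s', r) : ℝ × ℝ) := by fun_prop
        filter_upwards [hc.continuousAt.preimage_mem_nhds (hW.mem_nhds hs)] with s' hs'
        exact hF _ hs'
      simpa [ptD] using this.deriv_eq
    · rintro ⟨s, r⟩ hs
      have : (fun r' => F s r') =ᶠ[𝓝 r] fun _ => 0 := by
        have hc : Continuous fun r' : ℝ => ((s, r') : ℝ × ℝ) := by fun_prop
        filter_upwards [hc.continuousAt.preimage_mem_nhds (hW.mem_nhds hs)] with r' hr'
        exact hF _ hr'
      simpa [pxD] using this.deriv_eq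
  have k0 := key φ h0
  have k1 := key _ k0.1
  have k2 := key _ k0.2
  unfold MasterEqAt at heq
  rw [h0 _ hz, k0.1 _ hz, k0.2 _ hz, k1.1 _ hz, k2.1 _ hz, k2.2 _ hz] at heq
  have hne : 8 * lam * Real.exp ((0 - 3) * x) ≠ 0 :=
    mul_ne_zero (mul_ne_zero (by norm_num) hlam) (Real.exp_pos _).ne'
  have : 8 * lam * Real.exp ((0 - 3) * x) * μ₀ (t * Real.exp x) = 0 := by
    rw [← heq]; ring
  exact (mul_eq_zero.1 this).resolve_left hne

end CompactSupport

section GoursatExtension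

open Set Filter Topology MeasureTheory

theorem goursat_eq_zero {p q x y : ℝ} {K u v : ℝ → ℝ → ℝ}
    (hK : Continuous (fun z : ℝ × ℝ => K z.1 z.2))
    (hu : ContinuousOn (fun z : ℝ × ℝ => u z.1 z.2) (uIcc p x ×ˢ uIcc q y))
    (hv : ContinuousOn (fun z : ℝ × ℝ => v z.1 z.2) (uIcc p x ×ˢ uIcc q y))
    (h₁ : ∀ s ∈ uIcc p x, ∀ r ∈ uIcc q y, HasDerivAt (fun s' => u s' r) (v s r) s)
    (h₂ : ∀ s ∈ uIcc p x, ∀ r ∈ uIcc q y, HasDerivAt (fun r' => v s r') (K s r * u s r) r)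
    (b₁ : ∀ r ∈ uIcc q y, u p r = 0) (b₂ : ∀ s ∈ uIcc p x, u s q = 0) : u x y = 0 := by
  refine goursat_unique hK.continuousOn hu fun x' hx' y' hy' => ?_
  have hsx : uIcc p x' ⊆ uIcc p x := uIcc_subset_uIcc left_mem_uIcc hx'
  have hsy : uIcc q y' ⊆ uIcc q y := uIcc_subset_uIcc left_mem_uIcc hy'
  have hs := prod_mono hsx hsy
  rw [integral_mixed_deriv (N := fun s r => K s r * u s r) (hv.mono hs)
    ((hK.continuousOn.mul hu).mono hs) (fun s hs r hr => h₁ s (hsx hs) r (hsy hr))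
    (fun s hs r hr => h₂ s (hsx hs) r (hsy hr)), b₁ _ hy', b₂ _ hx', b₁ q left_mem_uIcc]
  ring

/-- A field which near each point of a rectangle either solves the homogeneous equation or
vanishes, and has zero characteristic data, is zero. -/
theorem goursat_eq_zero_of_local {p q x y : ℝ} {K u v w w₁ : ℝ → ℝ → ℝ} {D : Set (ℝ × ℝ)}
    (hK : Continuous (fun z : ℝ × ℝ => K z.1 z.2)) (hD : IsOpen D)
    (hu : ContinuousOn (fun z : ℝ × ℝ => u z.1 z.2) D)
    (hv : ContinuousOn (fun z : ℝ × ℝ => v z.1 z.2) D)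
    (h₁ : ∀ s r, (s, r) ∈ D → HasDerivAt (fun s' => u s' r) (v s r) s)
    (hloc : ∀ s ∈ uIcc p x, ∀ r ∈ uIcc q y,
      ((s, r) ∈ D ∧ HasDerivAt (fun r' => v s r') (K s r * u s r) r ∧
        (∀ᶠ z : ℝ × ℝ in 𝓝 (s, r), w z.1 z.2 = u z.1 z.2) ∧
        ∀ᶠ z : ℝ × ℝ in 𝓝 (s, r), w₁ z.1 z.2 = v z.1 z.2) ∨
      ((∀ᶠ z : ℝ × ℝ in 𝓝 (s, r), w z.1 z.2 = 0) ∧ ∀ᶠ z : ℝ × ℝ in 𝓝 (s, r), w₁ z.1 z.2 = 0))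
    (b₁ : ∀ r ∈ uIcc q y, w p r = 0) (b₂ : ∀ s ∈ uIcc p x, w s q = 0) : w x y = 0 := by
  have c1 : ∀ s r : ℝ, Tendsto (fun s' : ℝ => ((s', r) : ℝ × ℝ)) (𝓝 s) (𝓝 (s, r)) := fun s r =>
    (Continuous.prodMk_left r).tendsto s
  have c2 : ∀ s r : ℝ, Tendsto (fun r' : ℝ => ((s, r') : ℝ × ℝ)) (𝓝 r) (𝓝 (s, r)) := fun s r =>
    (Continuous.prodMk_right s).tendsto r
  refine goursat_eq_zero (v := w₁) hK ?_ ?_ ?_ ?_ b₁ b₂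
  · rintro ⟨s, r⟩ ⟨hs, hr⟩
    refine ContinuousAt.continuousWithinAt ?_
    rcases hloc s hs r hr with ⟨hm, -, hw, -⟩ | ⟨hw, -⟩
    · exact (hu.continuousAt (hD.mem_nhds hm)).congr (hw.mono fun _ h => h.symm)
    · exact continuousAt_const.congr (hw.mono fun _ h => h.symm)
  · rintro ⟨s, r⟩ ⟨hs, hr⟩
    refine ContinuousAt.continuousWithinAt ?_
    rcases hloc s hs r hr with ⟨hm, -, -, hw⟩ | ⟨-, hw⟩
    · exact (hv.continuousAt (hD.mem_nhds hm)).congr (hw.mono fun _ h => h.symm)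
    · exact continuousAt_const.congr (hw.mono fun _ h => h.symm)
  · intro s hs r hr
    rcases hloc s hs r hr with ⟨hm, -, hw, hw'⟩ | ⟨hw, hw'⟩
    · rw [show w₁ s r = v s r from hw'.self_of_nhds]
      exact (h₁ s r hm).congr_of_eventuallyEq ((c1 s r).eventually hw)
    · rw [show w₁ s r = 0 from hw'.self_of_nhds]
      exact (hasDerivAt_const s (0 : ℝ)).congr_of_eventuallyEq ((c1 s r).eventually hw)
  · intro s hs r hr
    rcases hloc s hs r hr with ⟨-, hd, hw, hw'⟩ | ⟨hw, hw'⟩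
    · rw [show w s r = u s r from hw.self_of_nhds]
      exact hd.congr_of_eventuallyEq ((c2 s r).eventually hw')
    · rw [show w s r = 0 from hw.self_of_nhds, mul_zero]
      exact (hasDerivAt_const r (0 : ℝ)).congr_of_eventuallyEq ((c2 s r).eventually hw')

/-- Smooth solution of the characteristic problem in a square. -/
theorem exists_goursat_solution {p q M : ℝ} (hp : |p| < M) (hq : |q| < M) {K G : ℝ → ℝ → ℝ}
    {g : ℝ → ℝ} (hK : ContDiff ℝ (⊤ : ℕ∞) (fun z : ℝ × ℝ => K z.1 z.2))
    (hG : ContDiff ℝ (⊤ : ℕ∞) (fun z : ℝ × ℝ => G z.1 z.2)) (hg : ContDiff ℝ (⊤ : ℕ∞) g) :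
    ∃ w w₁ : ℝ → ℝ → ℝ, ContDiff ℝ (⊤ : ℕ∞) (fun z : ℝ × ℝ => w z.1 z.2) ∧
      Continuous (fun z : ℝ × ℝ => w₁ z.1 z.2) ∧ ∀ x y, |x| < M → |y| < M →
        HasDerivAt (fun s => w s y) (w₁ x y) x ∧
        HasDerivAt (fun r => w₁ x r) (K x y * w x y + G x y) y ∧
        w p y = g y ∧ w x q = g q := by
  have hM : 0 < M := (abs_nonneg p).trans_lt hp
  let χ : ContDiffBump (0 : ℝ × ℝ) := ⟨M, M + 1, hM, by linarith⟩
  have hχ1 : ∀ s r, |s| < M → |r| < M → χ (s, r) = 1 := by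
    intro s r hs hr
    refine χ.one_of_mem_closedBall ?_
    rw [mem_closedBall_zero_iff, Prod.norm_def]
    exact max_le hs.le hr.le
  have hbound : ∀ {A : ℝ → ℝ → ℝ}, Continuous (fun z : ℝ × ℝ => A z.1 z.2) →
      ∃ C, ∀ s r, |χ (s, r) * A s r| ≤ C := by
    intro A hA
    obtain ⟨C, hC⟩ := (χ.continuous.mul hA).bounded_above_of_compact_support
      χ.hasCompactSupport.mul_right
    exact ⟨C, fun s r => hC (s, r)⟩
  have hχ : ContDiff ℝ (⊤ : ℕ∞) (fun z : ℝ × ℝ => χ (z.1, z.2)) := χ.contDiff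
  have hI : ContDiff ℝ (⊤ : ℕ∞)
      (fun z : ℝ × ℝ => g z.2 + ∫ s in p..z.1, ∫ r in q..z.2, G s r) := by
    refine (hg.comp contDiff_snd).add (contDiff_infty.2 fun n => ?_)
    exact (contDiff_succ_iterated_intervalIntegral p q (hG.of_le
      (WithTop.coe_le_coe.2 le_top))).of_le (by exact_mod_cast Nat.le_succ n)
  obtain ⟨C, hC⟩ := hbound hK.continuous
  obtain ⟨C', hC'⟩ := hbound (A := fun x y => g y + ∫ s in p..x, ∫ r in q..y, G s r) hI.continuous
  have hχK := hχ.mul hK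
  obtain ⟨w, hw, hwe⟩ := goursat_exists (p := p) (q := q) (K := fun s r => χ (s, r) * K s r)
    (a := fun x y => χ (x, y) * (g y + ∫ s in p..x, ∫ r in q..y, G s r)) hχK.continuous hC
    (hχ.mul hI).continuous hC'
  have hws := contDiff_of_goursat hχK (hχ.mul hI) hw hwe
  have hN : Continuous (fun z : ℝ × ℝ => χ (z.1, z.2) * K z.1 z.2 * w z.1 z.2) :=
    hχK.continuous.mul hw
  have hi1 := continuous_intervalIntegral_snd (N := G) q hG.continuous
  have hi2 := continuous_intervalIntegral_snd
    (N := fun s r => χ (s, r) * K s r * w s r) q hN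
  refine ⟨w, fun x y => (∫ r in q..y, G x r) + ∫ r in q..y, χ (x, r) * K x r * w x r, hws,
    hi1.add hi2, fun x y hx hy => ⟨?_, ?_, ?_, ?_⟩⟩
  · have e : (fun s => w s y) =ᶠ[𝓝 x] fun s => g y + (∫ s' in p..s, ∫ r in q..y, G s' r)
        + ∫ s' in p..s, ∫ r in q..y, χ (s', r) * K s' r * w s' r := by
      filter_upwards [(isOpen_lt continuous_abs continuous_const).mem_nhds
        (show x ∈ {s : ℝ | |s| < M} from hx)] with s hs
      rw [hwe s y, hχ1 s y hs hy, one_mul]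
    have j1 : Continuous fun s => ∫ r in q..y, G s r :=
      hi1.comp (Continuous.prodMk_left y)
    have j2 : Continuous fun s => ∫ r in q..y, χ (s, r) * K s r * w s r :=
      hi2.comp (Continuous.prodMk_left y)
    refine HasDerivAt.congr_of_eventuallyEq ?_ e
    exact ((j1.integral_hasStrictDerivAt p x).hasDerivAt.const_add (g y)).add
      (j2.integral_hasStrictDerivAt p x).hasDerivAt
  · have j1 : Continuous fun r => G x r := hG.continuous.comp (Continuous.prodMk_right x)
    have j2 : Continuous fun r => χ (x, r) * K x r * w x r :=
      hN.comp (Continuous.prodMk_right x)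
    refine ((j1.integral_hasStrictDerivAt q y).hasDerivAt.add
      (j2.integral_hasStrictDerivAt q y).hasDerivAt).congr_deriv ?_
    rw [hχ1 x y hx hy]; ring
  · rw [hwe p y, hχ1 p y hp hy]; simp
  · rw [hwe x q, hχ1 x q hx hq]; simp

end GoursatExtension

section CharacteristicExtension

open Set Filter Topology

theorem charField_vanish_aux {q hi ha hb h0 yc ε X₁ X₂ y₁ y₂ : ℝ} {u v K G : ℝ → ℝ → ℝ}
    (h0a : ha < h0) (h0b : h0 < hb)
    (hK : Continuous (fun z : ℝ × ℝ => K z.1 z.2))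
    (hu : ContinuousOn (fun z : ℝ × ℝ => u z.1 z.2) {z | 0 < z.1 ∧ z.1 < hi * Real.exp (q * z.2)})
    (hv : ContinuousOn (fun z : ℝ × ℝ => v z.1 z.2) {z | 0 < z.1 ∧ z.1 < hi * Real.exp (q * z.2)})
    (h₁ : ∀ X y, 0 < X → X < hi * Real.exp (q * y) → HasDerivAt (fun s => u s y) (v X y) X)
    (h₂ : ∀ X y, 0 < X → X < hi * Real.exp (q * y) →
      HasDerivAt (fun r => v X r) (K X y * u X y + G X y) y)
    (hG : ∀ X y, y < yc → G X y = 0)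
    (hz : ∀ X y, y < yc → ha * Real.exp (q * y) < X → X < hb * Real.exp (q * y) →
      u X y = 0 ∧ v X y = 0)
    (hyc : ∀ r ∈ uIcc y₂ y₁, r < yc)
    (hside : ∀ s ∈ uIcc X₂ X₁, ∀ r ∈ uIcc y₂ y₁, 0 < ε * (h0 * Real.exp (q * r) - s) →
      0 < s ∧ s < hi * Real.exp (q * r))
    (hb₁ : ∀ r ∈ uIcc y₂ y₁, ε * (h0 * Real.exp (q * r) - X₂) ≤ 0)
    (hb₂ : ∀ s ∈ uIcc X₂ X₁, ε * (h0 * Real.exp (q * y₂) - s) ≤ 0)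
    (hm : 0 < ε * (h0 * Real.exp (q * y₁) - X₁)) : u X₁ y₁ = 0 := by
  classical
  have hcW : Continuous fun z : ℝ × ℝ => ε * (h0 * Real.exp (q * z.2) - z.1) := by fun_prop
  have hD : IsOpen {z : ℝ × ℝ | 0 < z.1 ∧ z.1 < hi * Real.exp (q * z.2)} :=
    (isOpen_lt continuous_const continuous_fst).inter
      (isOpen_lt continuous_fst (by fun_prop))
  have key := goursat_eq_zero_of_local (p := X₂) (q := y₂) (x := X₁) (y := y₁)
    (w := fun s r => if 0 < ε * (h0 * Real.exp (q * r) - s) then u s r else 0)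
    (w₁ := fun s r => if 0 < ε * (h0 * Real.exp (q * r) - s) then v s r else 0)
    hK hD hu hv (fun s r h => h₁ s r h.1 h.2) ?_ ?_ ?_
  · simpa only [if_pos hm] using key
  · intro s hs r hr
    rcases lt_trichotomy (ε * (h0 * Real.exp (q * r) - s)) 0 with h | h | h
    · right
      have : ∀ᶠ z : ℝ × ℝ in 𝓝 (s, r), ε * (h0 * Real.exp (q * z.2) - z.1) < 0 :=
        hcW.continuousAt.eventually_lt continuousAt_const h
      exact ⟨this.mono fun z hz' => if_neg hz'.not_gt, this.mono fun z hz' => if_neg hz'.not_gt⟩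
    · right
      have hε : ε ≠ 0 := by rintro rfl; simp at hm
      have hs' : s = h0 * Real.exp (q * r) := by
        have := (mul_eq_zero.1 h).resolve_left hε
        linarith
      have e := Real.exp_pos (q * r)
      have e1 : ∀ᶠ z : ℝ × ℝ in 𝓝 (s, r), z.2 < yc :=
        continuousAt_snd.eventually_lt continuousAt_const (hyc r hr)
      have e2 : ∀ᶠ z : ℝ × ℝ in 𝓝 (s, r), ha * Real.exp (q * z.2) < z.1 :=
        ContinuousAt.eventually_lt (by fun_prop) (by fun_prop) (by simp only [hs']; gcongr)
      have e3 : ∀ᶠ z : ℝ × ℝ in 𝓝 (s, r), z.1 < hb * Real.exp (q * z.2) :=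
        ContinuousAt.eventually_lt (by fun_prop) (by fun_prop) (by simp only [hs']; gcongr)
      have e4 : ∀ᶠ z : ℝ × ℝ in 𝓝 (s, r), u z.1 z.2 = 0 ∧ v z.1 z.2 = 0 := by
        filter_upwards [e1, e2, e3] with z z1 z2 z3 using hz _ _ z1 z2 z3
      exact ⟨e4.mono fun z hz' => by simp [hz'.1], e4.mono fun z hz' => by simp [hz'.2]⟩
    · left
      have hd := hside s hs r hr h
      have : ∀ᶠ z : ℝ × ℝ in 𝓝 (s, r), 0 < ε * (h0 * Real.exp (q * z.2) - z.1) :=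
        continuousAt_const.eventually_lt hcW.continuousAt h
      refine ⟨hd, ?_, this.mono fun z hz' => if_pos hz', this.mono fun z hz' => if_pos hz'⟩
      simpa [hG s r (hyc r hr)] using h₂ s r hd.1 hd.2
  · exact fun r hr => if_neg (hb₁ r hr).not_gt
  · exact fun s hs => if_neg (hb₂ s hs).not_gt

/-- A field vanishing near a spacelike curve `X = h0 e^{q y}`, `y < yc`, vanishes in its domain
of dependence. -/
theorem charField_vanish {q hi ha hb h0 yc : ℝ} {u v K G : ℝ → ℝ → ℝ}
    (hq : 0 < q) (ha0 : 0 < ha) (h0a : ha < h0) (h0b : h0 < hb) (hbi : hb < hi)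
    (hK : Continuous (fun z : ℝ × ℝ => K z.1 z.2))
    (hu : ContinuousOn (fun z : ℝ × ℝ => u z.1 z.2) {z | 0 < z.1 ∧ z.1 < hi * Real.exp (q * z.2)})
    (hv : ContinuousOn (fun z : ℝ × ℝ => v z.1 z.2) {z | 0 < z.1 ∧ z.1 < hi * Real.exp (q * z.2)})
    (h₁ : ∀ X y, 0 < X → X < hi * Real.exp (q * y) → HasDerivAt (fun s => u s y) (v X y) X)
    (h₂ : ∀ X y, 0 < X → X < hi * Real.exp (q * y) →
      HasDerivAt (fun r => v X r) (K X y * u X y + G X y) y)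
    (hG : ∀ X y, y < yc → G X y = 0)
    (hz : ∀ X y, y < yc → ha * Real.exp (q * y) < X → X < hb * Real.exp (q * y) → u X y = 0)
    {X y : ℝ} (hX0 : 0 < X) (hXi : X < hi * Real.exp (q * y))
    (hXc : X < h0 * Real.exp (q * yc)) (hy : y < yc) : u X y = 0 := by
  have h0p : 0 < h0 := ha0.trans h0a
  have hz' : ∀ X y, y < yc → ha * Real.exp (q * y) < X → X < hb * Real.exp (q * y) →
      u X y = 0 ∧ v X y = 0 := by
    intro X y hy h1 h2
    have e := Real.exp_pos (q * y)
    refine ⟨hz X y hy h1 h2, ?_⟩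
    have hev : (fun s => u s y) =ᶠ[𝓝 X] fun _ => 0 := by
      filter_upwards [isOpen_Ioo.mem_nhds (⟨h1, h2⟩ : X ∈ Ioo _ _)] with s hs
      exact hz s y hy hs.1 hs.2
    exact (h₁ X y ((by positivity : 0 < ha * Real.exp (q * y)).trans h1)
      (h2.trans (by gcongr))).unique ((hasDerivAt_const X (0 : ℝ)).congr_of_eventuallyEq hev)
  have mono : ∀ r r', r ≤ r' → h0 * Real.exp (q * r) ≤ h0 * Real.exp (q * r') := by
    intro r r' h; gcongr
  have hlt : ∀ r, h0 * Real.exp (q * r) < hi * Real.exp (q * r) := by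
    intro r; have := h0b.trans hbi; gcongr
  obtain ⟨y₂, hy₂⟩ : ∃ y₂, h0 * Real.exp (q * y₂) = X := by
    refine ⟨Real.log (X / h0) / q, ?_⟩
    rw [mul_div_cancel₀ _ hq.ne', Real.exp_log (div_pos hX0 h0p), mul_div_cancel₀ _ h0p.ne']
  have hiff : ∀ r r', h0 * Real.exp (q * r) < h0 * Real.exp (q * r') → r < r' := by
    intro r r' h
    by_contra hn
    exact absurd (mono _ _ (not_lt.1 hn)) h.not_ge
  have hy₂c : y₂ < yc := hiff _ _ (hy₂ ▸ hXc)
  rcases lt_trichotomy X (h0 * Real.exp (q * y)) with h | h | h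
  · have hle : y₂ ≤ y := (hiff _ _ (hy₂ ▸ h)).le
    refine charField_vanish_aux (ε := 1) (X₂ := h0 * Real.exp (q * y)) (y₂ := y₂) h0a h0b hK hu hv
      h₁ h₂ hG hz' ?_ ?_ ?_ ?_ ?_
    · intro r hr
      rw [uIcc_of_le hle] at hr
      exact hr.2.trans_lt hy
    · intro s hs r hr h'
      rw [uIcc_of_ge h.le] at hs
      exact ⟨hX0.trans_le hs.1, lt_trans (by linarith) (hlt r)⟩
    · intro r hr
      rw [uIcc_of_le hle] at hr
      linarith [mono _ _ hr.2]
    · intro s hs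
      rw [uIcc_of_ge h.le] at hs
      linarith [hs.1]
    · linarith
  · have e := Real.exp_pos (q * y)
    exact hz X y hy (by rw [h]; gcongr) (by rw [h]; gcongr)
  · have hle : y ≤ y₂ := (hiff _ _ (hy₂ ▸ h)).le
    refine charField_vanish_aux (ε := -1) (X₂ := h0 * Real.exp (q * y)) (y₂ := y₂) h0a h0b hK hu hv
      h₁ h₂ hG hz' ?_ ?_ ?_ ?_ ?_
    · intro r hr
      rw [uIcc_of_ge hle] at hr
      exact hr.2.trans_lt hy₂c
    · intro s hs r hr h'
      rw [uIcc_of_le h.le] at hs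
      rw [uIcc_of_ge hle] at hr
      refine ⟨(by positivity : 0 < h0 * Real.exp (q * y)).trans_le hs.1, hs.2.trans_lt
        (hXi.trans_le ?_)⟩
      have := (h0p.trans h0b).trans hbi
      have := hr.1
      gcongr
    · intro r hr
      rw [uIcc_of_ge hle] at hr
      linarith [mono _ _ hr.1]
    · intro s hs
      rw [uIcc_of_le h.le] at hs
      linarith [hs.2]
    · linarith

end CharacteristicExtension

section HorizonExtension

open Set Filter Topology

/-- A solution of the characteristic equation on `0 < X < hi e^{q y}` that vanishes near a curve
`X = h0 e^{q y}`, `y < yc`, extends smoothly to the horizon `X = 0`. -/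
theorem exists_extension_to_horizon {q hi ha hb h0 yc : ℝ} {u v K G : ℝ → ℝ → ℝ}
    (hq : 0 < q) (ha0 : 0 < ha) (h0a : ha < h0) (h0b : h0 < hb) (hbi : hb < hi)
    (hK : ContDiff ℝ (⊤ : ℕ∞) (fun z : ℝ × ℝ => K z.1 z.2))
    (hG : ContDiff ℝ (⊤ : ℕ∞) (fun z : ℝ × ℝ => G z.1 z.2))
    (hu : ContDiffOn ℝ (⊤ : ℕ∞) (fun z : ℝ × ℝ => u z.1 z.2)
      {z | 0 < z.1 ∧ z.1 < hi * Real.exp (q * z.2)})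
    (hv : ContinuousOn (fun z : ℝ × ℝ => v z.1 z.2) {z | 0 < z.1 ∧ z.1 < hi * Real.exp (q * z.2)})
    (h₁ : ∀ X y, 0 < X → X < hi * Real.exp (q * y) → HasDerivAt (fun s => u s y) (v X y) X)
    (h₂ : ∀ X y, 0 < X → X < hi * Real.exp (q * y) →
      HasDerivAt (fun r => v X r) (K X y * u X y + G X y) y)
    (hG0 : ∀ X y, y < yc → G X y = 0)
    (hz : ∀ X y, y < yc → ha * Real.exp (q * y) < X → X < hb * Real.exp (q * y) → u X y = 0) :
    ∃ X₀ : ℝ, 0 < X₀ ∧ ∃ U : ℝ → ℝ → ℝ,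
      ContDiffOn ℝ (⊤ : ℕ∞) (fun z : ℝ × ℝ => U z.1 z.2) (Icc 0 X₀ ×ˢ univ) ∧
      ∀ X y, 0 < X → X < hi * Real.exp (q * y) → X ≤ X₀ → U X y = u X y := by
  classical
  have h0p : 0 < h0 := ha0.trans h0a
  have hD : IsOpen {z : ℝ × ℝ | 0 < z.1 ∧ z.1 < hi * Real.exp (q * z.2)} :=
    (isOpen_lt continuous_const continuous_fst).inter
      (isOpen_lt continuous_fst (by fun_prop))
  have hvan : ∀ X y, 0 < X → X < hi * Real.exp (q * y) → X < h0 * Real.exp (q * yc) → y < yc →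
      u X y = 0 := fun X y hX hXi hXc hy =>
    charField_vanish hq ha0 h0a h0b hbi hK.continuous hu.continuousOn hv h₁ h₂ hG0 hz hX hXi hXc hy
  obtain ⟨Xc, hXc⟩ : ∃ Xc, Xc = h0 * Real.exp (q * yc) := ⟨_, rfl⟩
  have hXcp : 0 < Xc := hXc ▸ mul_pos h0p (Real.exp_pos _)
  rw [← hXc] at hvan
  obtain ⟨C, hC⟩ : ∃ C, h0 * Real.exp (q * C) = 3 * Xc / 4 := by
    refine ⟨Real.log (3 * Xc / 4 / h0) / q, ?_⟩
    rw [mul_div_cancel₀ _ hq.ne', Real.exp_log (by positivity), mul_div_cancel₀ _ h0p.ne']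
  have hCyc : C < yc := by
    by_contra hn
    have : h0 * Real.exp (q * yc) ≤ h0 * Real.exp (q * C) := by
      have := not_lt.1 hn
      gcongr
    linarith
  have hin : ∀ X y, X ≤ 3 * Xc / 4 → C ≤ y → X < hi * Real.exp (q * y) := by
    intro X y hX hy
    calc X ≤ h0 * Real.exp (q * C) := hC ▸ hX
      _ ≤ h0 * Real.exp (q * y) := by gcongr
      _ < hi * Real.exp (q * y) := by
        have := h0b.trans hbi
        gcongr
  obtain ⟨q', hq'C, hq'y⟩ := exists_between hCyc
  obtain ⟨p, hp⟩ : ∃ p, p = Xc / 2 := ⟨_, rfl⟩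
  have hg : ContDiff ℝ (⊤ : ℕ∞) (fun y => if y < yc then 0 else u p y) := by
    rw [contDiff_iff_contDiffAt]
    intro y
    rcases lt_or_ge y yc with hy | hy
    · refine (contDiffAt_const (c := (0 : ℝ))).congr_of_eventuallyEq ?_
      filter_upwards [isOpen_Iio.mem_nhds hy] with r hr using if_pos hr
    · have hm : (p, y) ∈ {z : ℝ × ℝ | 0 < z.1 ∧ z.1 < hi * Real.exp (q * z.2)} :=
        ⟨by linarith, hin p y (by linarith) (hCyc.le.trans hy)⟩
      have hc : ContDiffAt ℝ (⊤ : ℕ∞) (fun r => u p r) y :=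
        (hu.contDiffAt (hD.mem_nhds hm)).comp y (f := fun r : ℝ => ((p, r) : ℝ × ℝ)) (by fun_prop)
      refine hc.congr_of_eventuallyEq ?_
      filter_upwards [isOpen_Ioi.mem_nhds (hCyc.trans_le hy)] with r hr
      split_ifs with h
      · exact (hvan p r (by linarith) (hin p r (by linarith) (le_of_lt hr)) (by linarith) h).symm
      · rfl
  have hgu : ∀ r, C ≤ r → (if r < yc then 0 else u p r) = u p r := by
    intro r hr
    split_ifs with h
    · exact (hvan p r (by linarith) (hin p r (by linarith) hr) (by linarith) h).symm
    · rfl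
  obtain ⟨M₀, hM₀⟩ : ∃ M₀, M₀ = |q'| + Xc + |yc| + |C| := ⟨_, rfl⟩
  have hM₀q : |q'| < M₀ := by linarith [abs_nonneg yc, abs_nonneg C]
  have hM₀X : Xc ≤ M₀ := by linarith [abs_nonneg yc, abs_nonneg C, abs_nonneg q']
  have hloc : ∀ M, ∃ w : ℝ → ℝ → ℝ, M₀ ≤ M →
      (ContDiff ℝ (⊤ : ℕ∞) (fun z : ℝ × ℝ => w z.1 z.2) ∧
      ∀ X y, 0 < X → X ≤ Xc / 4 → C < y → |y| < M → w X y = u X y) := by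
    intro M
    by_cases hM : M₀ ≤ M
    swap
    · exact ⟨fun _ _ => 0, fun h => absurd h hM⟩
    obtain ⟨w, w₁, hw, hw₁, hwd⟩ := exists_goursat_solution (p := p) (q := q') (M := M)
      (by rw [abs_of_pos (by linarith)]; linarith) (hM₀q.trans_le hM) hK hG hg
    refine ⟨w, fun _ => ⟨hw, fun X y hX hX₀ hy hyM => ?_⟩⟩
    have hsX : ∀ s ∈ uIcc p X, 0 < s ∧ s ≤ p := by
      intro s hs
      rw [uIcc_of_ge (by linarith)] at hs
      exact ⟨hX.trans_le hs.1, hs.2⟩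
    have hsM : ∀ s ∈ uIcc p X, |s| < M := by
      intro s hs
      have := hsX s hs
      rw [abs_of_pos this.1]
      linarith
    have hrC : ∀ r ∈ uIcc q' y, C < r := fun r hr =>
      (lt_min hq'C hy).trans_le hr.1
    have hrM : ∀ r ∈ uIcc q' y, |r| < M := by
      intro r hr
      have h1 := abs_lt.1 (hM₀q.trans_le hM)
      have h2 := abs_lt.1 hyM
      exact abs_lt.2 ⟨(lt_min h1.1 h2.1).trans_le hr.1, hr.2.trans_lt (max_lt h1.2 h2.2)⟩
    have hR' : ∀ s ∈ uIcc p X, ∀ r ∈ uIcc q' y, 0 < s ∧ s < hi * Real.exp (q * r) :=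
      fun s hs r hr => ⟨(hsX s hs).1, hin s r (by linarith [hsX s hs]) (hrC r hr).le⟩
    have hR : uIcc p X ×ˢ uIcc q' y ⊆ {z : ℝ × ℝ | 0 < z.1 ∧ z.1 < hi * Real.exp (q * z.2)} :=
      fun z hz => hR' z.1 hz.1 z.2 hz.2
    have hzero := goursat_eq_zero (p := p) (q := q') (x := X) (y := y) (K := K)
      (u := fun s r => w s r - u s r) (v := fun s r => w₁ s r - v s r) hK.continuous
      (hw.continuous.continuousOn.sub (hu.continuousOn.mono hR))
      (hw₁.continuousOn.sub (hv.mono hR))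
      (fun s hs r hr => (hwd s r (hsM s hs) (hrM r hr)).1.sub
        (h₁ s r (hR' s hs r hr).1 (hR' s hs r hr).2))
      (fun s hs r hr => ((hwd s r (hsM s hs) (hrM r hr)).2.1.sub
        (h₂ s r (hR' s hs r hr).1 (hR' s hs r hr).2)).congr_deriv (by ring))
      (fun r hr => by
        rw [(hwd p r (hsM p left_mem_uIcc) (hrM r hr)).2.2.1, hgu r (hrC r hr).le, sub_self])
      (fun s hs => by
        have := hR' s hs q' left_mem_uIcc
        rw [(hwd s q' (hsM s hs) (hrM q' left_mem_uIcc)).2.2.2, if_pos hq'y,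
          hvan s q' this.1 this.2 (by linarith [hsX s hs]) hq'y, sub_self])
    linarith
  choose w hw using hloc
  obtain ⟨U, hU⟩ : ∃ U : ℝ → ℝ → ℝ, U = fun X y => if y < yc then 0 else w (|y| + 1 + M₀) X y :=
    ⟨_, rfl⟩
  have hUcont : ∀ y, Continuous fun X => U X y := by
    intro y
    simp only [hU]
    split_ifs with h
    · exact continuous_const
    · exact (hw _ (by linarith [abs_nonneg y])).1.continuous.comp (Continuous.prodMk_left y)
  have hUu : ∀ X y, 0 < X → X < hi * Real.exp (q * y) → X ≤ Xc / 4 → U X y = u X y := by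
    intro X y hX hXi hX₀
    simp only [hU]
    split_ifs with h
    · exact (hvan X y hX hXi (by linarith) h).symm
    · exact (hw _ (by linarith [abs_nonneg y])).2 X y hX hX₀ (hCyc.trans_le (not_lt.1 h))
        (by linarith [abs_nonneg q'])
  have hUw : ∀ M, M₀ ≤ M → ∀ X ∈ Icc 0 (Xc / 4), ∀ y, C < y → |y| < M → U X y = w M X y := by
    intro M hM X hX y hy hyM
    have hpos : ∀ s ∈ Ioc 0 (Xc / 4), U s y = w M s y := fun s hs => by
      rw [hUu s y hs.1 (hin s y (by linarith [hs.2]) hy.le) hs.2,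
        (hw M hM).2 s y hs.1 hs.2 hy hyM]
    have hcl : closure (Ioc 0 (Xc / 4)) = Icc 0 (Xc / 4) := closure_Ioc (by linarith)
    rw [← hcl] at hX
    exact closure_minimal hpos (isClosed_eq (hUcont y)
      ((hw M hM).1.continuous.comp (Continuous.prodMk_left y))) hX
  refine ⟨Xc / 4, by linarith, U, ?_, hUu⟩
  rintro ⟨X, y⟩ ⟨hX, -⟩
  rcases lt_or_ge C y with hy | hy
  · have hM : M₀ ≤ |y| + 1 + M₀ := by linarith [abs_nonneg y]
    refine ((hw _ hM).1.contDiffAt.contDiffWithinAt).congr_of_eventuallyEq ?_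
      (hUw _ hM X hX y hy (by linarith [abs_nonneg q']))
    have e1 : ∀ᶠ z : ℝ × ℝ in 𝓝 (X, y), C < z.2 :=
      continuousAt_const.eventually_lt continuousAt_snd hy
    have e2 : ∀ᶠ z : ℝ × ℝ in 𝓝 (X, y), |z.2| < |y| + 1 + M₀ :=
      continuousAt_snd.abs.eventually_lt continuousAt_const (by linarith [abs_nonneg q'])
    filter_upwards [nhdsWithin_le_nhds e1, nhdsWithin_le_nhds e2, self_mem_nhdsWithin]
      with z z1 z2 z3 using hUw _ hM z.1 z3.1 z.2 z1 z2
  · refine (contDiffAt_const (c := (0 : ℝ))).contDiffWithinAt.congr_of_eventuallyEq ?_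
      (by simp [hU, hy.trans_lt hCyc])
    have e1 : ∀ᶠ z : ℝ × ℝ in 𝓝 (X, y), z.2 < yc :=
      continuousAt_snd.eventually_lt continuousAt_const (hy.trans_lt hCyc)
    filter_upwards [nhdsWithin_le_nhds e1] with z z1
    simp [hU, z1]

end HorizonExtension

section SelfSimilarField

open Set Filter Topology

theorem mul_exp_neg_lt {X b q y : ℝ} : X * Real.exp (-q * y) < b ↔ X < b * Real.exp (q * y) := by
  rw [neg_mul, Real.exp_neg, ← div_eq_mul_inv, div_lt_iff₀ (Real.exp_pos _)]

theorem lt_mul_exp_neg {X b q y : ℝ} : b < X * Real.exp (-q * y) ↔ b * Real.exp (q * y) < X := by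
  rw [neg_mul, Real.exp_neg, ← div_eq_mul_inv, lt_div_iff₀ (Real.exp_pos _)]

/-- The extension theorem for the master equation, with the self-similar time `t` recovered from
the characteristic coordinates through `t = T (X e^{-q y})`. -/
theorem exists_charField_extension {lam ell ti t₁ q hi : ℝ} {T μ₀ : ℝ → ℝ} {φ : ℝ → ℝ → ℝ}
    {h : ℝ → ℝ} (hlam : lam ≠ 0) (hq : 0 < q) (hti : 0 < ti) (hti₁ : ti < t₁)
    (hT : ContDiff ℝ (⊤ : ℕ∞) T) (hanti : StrictAnti T) (hpos : ∀ z, 0 < T z)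
    (hrel : ∀ z, q * (z * deriv T z) = -(T z * (1 - T z / 2 + lam * T z ^ 2)))
    (hT0 : T 0 = t₁) (hTh : ∀ t ∈ Ico ti t₁, T (h t) = t) (hhi : hi = h ti)
    (hμ : ContDiff ℝ (⊤ : ℕ∞) μ₀)
    (hφ : ContDiffOn ℝ (⊤ : ℕ∞) (fun z : ℝ × ℝ => φ z.1 z.2) (Ico ti t₁ ×ˢ univ))
    (heq : ∀ t ∈ Ico ti t₁, ∀ x, MasterEqAt lam ell 0 μ₀ φ t x)
    (hc : ∀ t ∈ Ico ti t₁, HasCompactSupport (fun x => φ t x)) :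
    ∃ X₀ : ℝ, 0 < X₀ ∧ ∃ U : ℝ → ℝ → ℝ,
      ContDiffOn ℝ (⊤ : ℕ∞) (fun z : ℝ × ℝ => U z.1 z.2) (Icc 0 X₀ ×ˢ univ) ∧
      ∀ X y, 0 < X → X ≤ hi * Real.exp (q * y) → X ≤ X₀ → U X y = charField T q φ X y := by
  obtain ⟨a, ha, ha'⟩ := exists_between hti₁
  obtain ⟨b, hab, hb⟩ := exists_between ha'
  obtain ⟨c, d, m, hac, hcd, hdb, hzero⟩ := exists_Ioo_forall_lt_eq_zero hab
    (hφ.continuousOn.mono (prod_mono_left fun t ht => ⟨ha.le.trans ht.1, ht.2.trans_lt hb⟩))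
    fun t ht => hc t ⟨ha.le.trans ht.1, ht.2.trans_lt hb⟩
  have hTi : T hi = ti := hhi ▸ hTh ti ⟨le_rfl, hti₁⟩
  have hTc : T (h c) = c := hTh c ⟨by linarith, by linarith⟩
  have hTd : T (h d) = d := hTh d ⟨by linarith, by linarith⟩
  have hd0 : 0 < h d := by rw [← hanti.lt_iff_gt, hT0, hTd]; linarith
  have hdc : h d < h c := by rw [← hanti.lt_iff_gt, hTc, hTd]; exact hcd
  have hci : h c < hi := by rw [← hanti.lt_iff_gt, hTc, hTi]; linarith
  have hc0 : 0 < c := by linarith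
  have hO : IsOpen (Ioo ti t₁ ×ˢ (univ : Set ℝ)) := isOpen_Ioo.prod isOpen_univ
  have hφO := hφ.mono (prod_mono_left (t := (univ : Set ℝ)) (Ioo_subset_Ico_self (a := ti)))
  have hmem : ∀ X y, 0 < X → X < hi * Real.exp (q * y) → T (X * Real.exp (-q * y)) ∈ Ioo ti t₁ := by
    intro X y hX hXi
    refine ⟨?_, ?_⟩
    · rw [← hTi, hanti.lt_iff_gt]; exact mul_exp_neg_lt.2 hXi
    · rw [← hT0, hanti.lt_iff_gt]; exact mul_pos hX (Real.exp_pos _)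
  have hxm : ∀ t ∈ Ioo c d, ∀ y < Real.log c + m, y - Real.log t < m := by
    intro t ht y hy
    linarith [Real.log_lt_log hc0 ht.1]
  have hμ0 : ∀ y < Real.log c + m, μ₀ (Real.exp y) = 0 := by
    intro y hy
    obtain ⟨t, ht⟩ := nonempty_Ioo.2 hcd
    have ht0 : 0 < t := hc0.trans ht.1
    have := source_eq_zero_of_field_eq_zero hlam (W := Ioo c d ×ˢ Iio m)
      (isOpen_Ioo.prod isOpen_Iio) (fun z hz => hzero z.1 hz.1 z.2 hz.2)
      (⟨ht, hxm t ht y hy⟩ : (t, y - Real.log t) ∈ Ioo c d ×ˢ Iio m)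
      (heq t ⟨by linarith [ht.1], by linarith [ht.2]⟩ _)
    rwa [Real.exp_sub, Real.exp_log ht0, mul_div_cancel₀ _ ht0.ne'] at this
  obtain ⟨hu, hv⟩ := contDiffOn_charField (q := q) hO hφO hT hpos
  have hsub : {z : ℝ × ℝ | 0 < z.1 ∧ z.1 < hi * Real.exp (q * z.2)} ⊆
      {z | (T (z.1 * Real.exp (-q * z.2)), z.2 - Real.log (T (z.1 * Real.exp (-q * z.2)))) ∈
        Ioo ti t₁ ×ˢ (univ : Set ℝ)} := fun z hz => ⟨hmem z.1 z.2 hz.1 hz.2, mem_univ _⟩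
  obtain ⟨h0, hh0, hh0'⟩ := exists_between hdc
  obtain ⟨X₀, hX₀, U, hU, hUu⟩ := exists_extension_to_horizon (yc := Real.log c + m)
    (K := charPotential T q lam ell) (G := charSource T q lam μ₀) (u := charField T q φ)
    (v := charFieldX T q φ) hq hd0 hh0 hh0' hci (contDiff_charPotential hT)
    (contDiff_charSource hT hμ) (hu.mono hsub) (hv.continuousOn.mono hsub)
    (fun X y hX hXi => hasDerivAt_charField_fst hO hφO hT hpos ⟨hmem X y hX hXi, mem_univ _⟩)
    (fun X y hX hXi => hasDerivAt_charFieldX_snd hO hφO hT hpos hrel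
      ⟨hmem X y hX hXi, mem_univ _⟩ (heq _ (Ioo_subset_Ico_self (hmem X y hX hXi)) _))
    (fun X y hy => by rw [charSource, hμ0 y hy, mul_zero, neg_zero])
    (fun X y hy h1 h2 => by
      have ht : T (X * Real.exp (-q * y)) ∈ Ioo c d := by
        refine ⟨?_, ?_⟩
        · rw [← hTc, hanti.lt_iff_gt]; exact mul_exp_neg_lt.2 (hTc.symm ▸ h2)
        · rw [← hTd, hanti.lt_iff_gt]; exact lt_mul_exp_neg.2 (hTd.symm ▸ h1)
      rw [charField, hzero _ ht _ (hxm _ ht y hy), mul_zero])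
  refine ⟨X₀, hX₀, U, hU, fun X y hX hXi hXX₀ => ?_⟩
  have hE : EqOn (fun s => U s y) (fun s => charField T q φ s y) (Ioo 0 X) := fun s hs =>
    hUu s y hs.1 (hs.2.trans_le hXi) (hs.2.le.trans hXX₀)
  refine hE.of_subset_closure (t := Ioc 0 X) ?_ ?_ Ioo_subset_Ioc_self ?_ ⟨hX, le_rfl⟩
  · exact hU.continuousOn.comp (f := fun s : ℝ => ((s, y) : ℝ × ℝ)) (by fun_prop)
      fun s hs => ⟨⟨hs.1.le, hs.2.trans hXX₀⟩, mem_univ _⟩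
  · have cs : ContinuousOn (fun s : ℝ => ((s, y) : ℝ × ℝ)) (Ioc 0 X) := by fun_prop
    have cc := (contDiff_charCoords (q := q) hT hpos).continuous.comp_continuousOn cs
    refine ContinuousOn.mul (Real.continuous_exp.comp_continuousOn
      (continuousOn_const.mul cc.snd)) (hφ.continuousOn.comp cc fun s hs => ⟨⟨?_, ?_⟩, mem_univ _⟩)
    · refine hTi ▸ hanti.antitone ?_
      exact not_lt.1 fun hlt => absurd (lt_mul_exp_neg.1 hlt) (hs.2.trans hXi).not_gt
    · refine hT0 ▸ hanti ?_
      exact mul_pos hs.1 (Real.exp_pos _)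
  · rw [closure_Ioo hX.ne]
    exact Ioc_subset_Icc_self

end SelfSimilarField

/-- For C₀^∞ data f, g, μ₀ and Π the solution of the κ = 0 master equation,
the field Ψ = e^{3x}Π, expressed as a function of the null coordinates
X = (t₁−t)(t₂−t)^{(ν−1)/(ν+1)}e^{x/λ₁} (λ₁ = (ν+1)/(2ν)) and Y = te^x, extends to a C^∞
function on Ω = {(X,Y) : 0 ≤ X ≤ X₀, Y > 0} for some X₀ > 0; in particular all X- and
Y-derivatives of Ψ are finite at the Cauchy horizon X = 0. -/
theorem stmt_16 (lam ν t₁ t₂ lam₁ : ℝ) (hlam : lam ∈ Set.Ioo (0:ℝ) (1/16))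
    (hν : ν = Real.sqrt (1 - 16*lam)) (ht₁ : t₁ = (1 - ν)/(4*lam))
    (ht₂ : t₂ = (1 + ν)/(4*lam)) (hlam₁ : lam₁ = (ν + 1)/(2*ν))
    (l : ℕ) (hl : 2 ≤ l) (ell : ℝ) (hell : ell = ((l:ℝ) - 1)*((l:ℝ) + 2))
    (ti : ℝ) (hti : ti ∈ Set.Ioo (0:ℝ) t₁)
    (f g μ₀ : ℝ → ℝ)
    (hf : ContDiff ℝ (⊤ : ℕ∞) f ∧ HasCompactSupport f)
    (hg : ContDiff ℝ (⊤ : ℕ∞) g ∧ HasCompactSupport g)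
    (hμ : ContDiff ℝ (⊤ : ℕ∞) μ₀ ∧ HasCompactSupport μ₀)
    (Pfield : ℝ → ℝ → ℝ) (hP : IsMasterSol lam ell 0 ti t₁ μ₀ f g Pfield) :
    ∃ X₀ : ℝ, 0 < X₀ ∧ ∃ Ψ : ℝ → ℝ → ℝ,
      ContDiffOn ℝ (⊤ : ℕ∞) (fun p : ℝ × ℝ => Ψ p.1 p.2)
        (Set.Icc 0 X₀ ×ˢ Set.Ioi 0) ∧
      ∀ t ∈ Set.Ico ti t₁, ∀ x : ℝ,
        Xcoord t₁ t₂ ν lam₁ t x ≤ X₀ →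
        Ψ (Xcoord t₁ t₂ ν lam₁ t x) (t * Real.exp x) = Real.exp (3*x) * Pfield t x := by
  obtain ⟨hlam0, hlam1⟩ := hlam
  have hν0 : 0 < ν := hν ▸ Real.sqrt_pos.2 (by linarith)
  have hν2 : ν ^ 2 = 1 - 16 * lam := by rw [hν, Real.sq_sqrt (by linarith)]
  have hν1 : ν < 1 := by nlinarith
  have h1 : 0 < t₁ := hti.1.trans hti.2
  have h12 : t₁ < t₂ := by
    rw [ht₁, ht₂]; gcongr; linarith
  have hprod : lam * (t₁ * t₂) = 1 := by
    rw [ht₁, ht₂]; field_simp; linear_combination -hν2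
  have hsum : 2 * lam * (t₁ + t₂) = 1 := by
    rw [ht₁, ht₂]; field_simp; ring
  obtain ⟨p, hp⟩ : ∃ p, p = (ν - 1) / (ν + 1) := ⟨_, rfl⟩
  obtain ⟨q, hq⟩ : ∃ q, q = 1 / lam₁ := ⟨_, rfl⟩
  have hν1' : ν + 1 ≠ 0 := by linarith
  have hqp : q = 1 + p := by
    rw [hq, hp, hlam₁]; field_simp; ring
  have hpt : t₁ + p * t₂ = 0 := by
    rw [hp, ht₁, ht₂]; field_simp; ring
  have hq0 : 0 < q := by
    rw [hq, hlam₁]; positivity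
  obtain ⟨T, hT, hanti, hTmem, hTh, hrel⟩ := exists_vaidya_time h1 h12 hprod hsum hqp hpt
  have hT0 : T 0 = t₁ := by simpa using hTh t₁ ⟨h1, h12⟩
  have hTh' : ∀ t ∈ Set.Ico ti t₁, T ((t₁ - t) * (t₂ - t) ^ p * t ^ (-q)) = t := fun t ht =>
    hTh t ⟨hti.1.trans_le ht.1, ht.2.trans h12⟩
  obtain ⟨hφ, heq, -, -, hc⟩ := hP
  obtain ⟨X₀, hX₀, U, hU, hUu⟩ := exists_charField_extension hlam0.ne' hq0 hti.1 hti.2 hT hanti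
    (fun z => (hTmem z).1) hrel hT0 (h := fun t => (t₁ - t) * (t₂ - t) ^ p * t ^ (-q)) hTh' rfl
    hμ.1 hφ heq hc
  refine ⟨X₀, hX₀, fun X Y => U X (Real.log Y), ?_, fun t ht x hX => ?_⟩
  · refine hU.comp (f := fun z : ℝ × ℝ => ((z.1, Real.log z.2) : ℝ × ℝ))
      (contDiffOn_fst.prodMk (contDiffOn_snd.log fun z hz => (ne_of_gt hz.2))) ?_
    exact fun z hz => ⟨hz.1, Set.mem_univ _⟩
  · have ht0 : 0 < t := hti.1.trans_le ht.1
    have hlog : Real.log (t * Real.exp x) = x + Real.log t := by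
      rw [Real.log_mul ht0.ne' (Real.exp_pos x).ne', Real.log_exp, add_comm]
    have hXpos : 0 < Xcoord t₁ t₂ ν lam₁ t x :=
      mul_pos (mul_pos (by linarith [ht.2]) (Real.rpow_pos_of_pos (by linarith [ht.2]) _))
        (Real.exp_pos _)
    have hXh : Xcoord t₁ t₂ ν lam₁ t x * Real.exp (-q * (x + Real.log t))
        = (t₁ - t) * (t₂ - t) ^ p * t ^ (-q) := by
      rw [Xcoord, ← hp, Real.rpow_def_of_pos ht0, mul_assoc _ (Real.exp _), ← Real.exp_add, hq]
      congr 2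
      ring
    have hTX : T (Xcoord t₁ t₂ ν lam₁ t x * Real.exp (-q * (x + Real.log t))) = t := by
      rw [hXh, hTh' t ht]
    have hle : Xcoord t₁ t₂ ν lam₁ t x
        ≤ (t₁ - ti) * (t₂ - ti) ^ p * ti ^ (-q) * Real.exp (q * (x + Real.log t)) := by
      refine not_lt.1 fun hlt => ?_
      have := hanti (lt_mul_exp_neg.2 hlt)
      rw [hTX, hTh' ti ⟨le_rfl, hti.2⟩] at this
      exact absurd ht.1 this.not_ge
    simp only [hlog]
    rw [hUu _ _ hXpos hle hX, charField, hTX, add_sub_cancel_right]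
end
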